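/- arXiv:2201.00367 — 5 statements merged into one kernel-verified Lean document; each statement's English description precedes it below -/
import Mathlib

section
/- Let q = 2^f ≥ 4, let a ∈ 𝔽_q be such that the subfield of 𝔽_q generated by a is all of 𝔽_q, and let K be an algebraic closure of 𝔽_q. Let x'' and y'' be the 8×8 matrices over K with rows x'': [a,a²+1,a²+1,0,0,0,0,0], [1,a,a,0,0,1,1,0], [0,0,0,0,0,1,1,0], [0,0,0,0,0,0,0,1], [0,0,0,0,a,1,0,0], [0,0,0,0,a²+1,a,0,0], [0,0,1,0,a²+1,a,0,0], [0,0,0,1,0,0,0,0]; y'': [0,0,0,0,0,0,0,1], [−1,0,0,0,0,0,0,0], [0,0,−1,0,0,0,0,0], [0,0,0,0,0,1,0,0], [0,0,0,1,0,0,0,0], [0,0,0,0,−1,0,0,0], [0,0,0,0,0,0,−1,0], [0,1,0,0,0,0,0,0]. Then the only K-subspaces W of K⁸ with x''·W ⊆ W and y''·W ⊆ W are {0} and K⁸; that is, the subgroup ⟨x'', y''⟩ of GL₈(K) is absolutely irreducible. -/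
open Matrix

/-- The image `x'' = τ²(x(a))` under the square of triality of the order-2
generator of `Ω₈⁺(q)` in characteristic 2. -/
def xPlusEvenTau2 (K : Type*) [Field K] (a : K) : Matrix (Fin 8) (Fin 8) K :=
  !![a, a^2+1, a^2+1, 0, 0, 0, 0, 0;
     1, a, a, 0, 0, 1, 1, 0;
     0, 0, 0, 0, 0, 1, 1, 0;
     0, 0, 0, 0, 0, 0, 0, 1;
     0, 0, 0, 0, a, 1, 0, 0;
     0, 0, 0, 0, a^2+1, a, 0, 0;
     0, 0, 1, 0, a^2+1, a, 0, 0;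
     0, 0, 0, 1, 0, 0, 0, 0]

/-- The image `y'' = τ²(y)` under the square of triality of the order-3
generator of `Ω₈⁺(q)`. -/
def yPlusTau2 (K : Type*) [Field K] : Matrix (Fin 8) (Fin 8) K :=
  !![0, 0, 0, 0, 0, 0, 0, 1;
     -1, 0, 0, 0, 0, 0, 0, 0;
     0, 0, -1, 0, 0, 0, 0, 0;
     0, 0, 0, 0, 0, 1, 0, 0;
     0, 0, 0, 1, 0, 0, 0, 0;
     0, 0, 0, 0, -1, 0, 0, 0;
     0, 0, 0, 0, 0, 0, -1, 0;
     0, 1, 0, 0, 0, 0, 0, 0]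

namespace TauSquaredIrreducibility

/-- The vector of `K⁸` fixed by `y''` with coordinates `z` in the basis
`e₃, e₇, e₁ + e₂ + e₈, e₄ + e₅ + e₆` of the fixed space of `y''`. -/
def fixedVec (K : Type*) [Field K] : (Fin 4 → K) →ₗ[K] (Fin 8 → K) where
  toFun z := ![z 2, z 2, z 0, z 3, z 3, z 3, z 1, z 2]
  map_add' z z' := by ext i; fin_cases i <;> simp
  map_smul' c z := by ext i; fin_cases i <;> simp

/-- The matrix of the compression of `x''` to the fixed space of `y''`. -/
def compression {K : Type*} [Field K] (a : K) : Matrix (Fin 4) (Fin 4) K :=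
  !![0, 1, 0, 1;
     1, 0, 0, a^2+a+1;
     a^2+a+1, 1, a^2, 0;
     0, 0, 1, a^2]

theorem compression_mulVec {K : Type*} [Field K] (a : K) (z : Fin 4 → K) :
    (compression a).mulVec z = ![z 1 + z 3, z 0 + (a^2+a+1) * z 3,
      (a^2+a+1) * z 0 + z 1 + a^2 * z 2, z 2 + a^2 * z 3] := by
  ext i
  fin_cases i <;> simp [compression, mulVec, dotProduct, Fin.sum_univ_four]

section Invariant

variable {K : Type*} [Field K] {a : K} {W : Submodule K (Fin 8 → K)}

theorem xPlusEvenTau2_mulVec_mem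
    (hxW : ∀ w ∈ W, (xPlusEvenTau2 K a).mulVec w ∈ W)
    {w0 w1 w2 w3 w4 w5 w6 w7 : K} (hw : ![w0, w1, w2, w3, w4, w5, w6, w7] ∈ W) :
    ![a * w0 + (a^2+1) * (w1 + w2), w0 + a * (w1 + w2) + (w5 + w6), w5 + w6, w7,
      a * w4 + w5, (a^2+1) * w4 + a * w5, w2 + (a^2+1) * w4 + a * w5, w3] ∈ W := by
  convert hxW _ hw using 1
  ext i
  fin_cases i <;> simp [xPlusEvenTau2, mulVec, dotProduct, Fin.sum_univ_eight] <;> ring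

variable [CharP K 2]

theorem yPlusTau2_mulVec_mem
    (hyW : ∀ w ∈ W, (yPlusTau2 K).mulVec w ∈ W)
    {w0 w1 w2 w3 w4 w5 w6 w7 : K} (hw : ![w0, w1, w2, w3, w4, w5, w6, w7] ∈ W) :
    ![w7, w0, w2, w5, w3, w4, w6, w1] ∈ W := by
  convert hyW _ hw using 1
  ext i
  fin_cases i <;>
    simp [yPlusTau2, mulVec, dotProduct, Fin.sum_univ_eight, CharTwo.neg_eq]

theorem mem_comap_fixedVec_of_mem
    (hyW : ∀ w ∈ W, (yPlusTau2 K).mulVec w ∈ W)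
    {w0 w1 w2 w3 w4 w5 w6 w7 : K} (hw : ![w0, w1, w2, w3, w4, w5, w6, w7] ∈ W) :
    ![w2, w6, w0 + w1 + w7, w3 + w4 + w5] ∈ W.comap (fixedVec K) := by
  have h1 := yPlusTau2_mulVec_mem hyW hw
  have h2 := yPlusTau2_mulVec_mem hyW h1
  have h := W.add_mem (W.add_mem hw h1) h2
  rw [Submodule.mem_comap]
  convert h using 1
  ext i
  fin_cases i <;> simp [fixedVec] <;> grind

theorem compression_mulVec_mem
    (hxW : ∀ w ∈ W, (xPlusEvenTau2 K a).mulVec w ∈ W)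
    (hyW : ∀ w ∈ W, (yPlusTau2 K).mulVec w ∈ W)
    {z : Fin 4 → K} (hz : z ∈ W.comap (fixedVec K)) :
    (compression a).mulVec z ∈ W.comap (fixedVec K) := by
  have h := mem_comap_fixedVec_of_mem hyW (xPlusEvenTau2_mulVec_mem hxW hz)
  convert h using 1
  ext i
  fin_cases i <;>
    simp [compression_mulVec] <;> grind

/-- The action of the compression of `x'' y''² x''`. -/
theorem compression_xyyx_mem
    (hxW : ∀ w ∈ W, (xPlusEvenTau2 K a).mulVec w ∈ W)
    (hyW : ∀ w ∈ W, (yPlusTau2 K).mulVec w ∈ W)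
    {z0 z1 z2 z3 : K} (hz : ![z0, z1, z2, z3] ∈ W.comap (fixedVec K)) :
    ![z0 + z2 + (a^2+a+1) * z3, z1 + a * z2 + (a^4+a^3+a) * z3,
      (a^2+a+1) * z0 + a^2 * z1 + a^2 * z2 + (a^2+a+1) * z3,
      (a^2+1) * z0 + a^2 * z2 + (a^4+a^2+1) * z3] ∈ W.comap (fixedVec K) := by
  have h := mem_comap_fixedVec_of_mem hyW (xPlusEvenTau2_mulVec_mem hxW
    (yPlusTau2_mulVec_mem hyW (yPlusTau2_mulVec_mem hyW (xPlusEvenTau2_mulVec_mem hxW hz))))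
  convert h using 1
  ext i
  fin_cases i <;> simp <;> grind

/-- The action of the compression of `x'' y'' x'' y''² x''`. -/
theorem compression_xyxyyx_mem
    (hxW : ∀ w ∈ W, (xPlusEvenTau2 K a).mulVec w ∈ W)
    (hyW : ∀ w ∈ W, (yPlusTau2 K).mulVec w ∈ W)
    {z0 z1 z2 z3 : K} (hz : ![z0, z1, z2, z3] ∈ W.comap (fixedVec K)) :
    ![z1 + (a+1) * z2 + (a^4+a^2) * z3,
      a^4 * z0 + (a^4+a^3) * z2 + (a^4+a^3+a+1) * z3,
      (a^4+a^3+a+1) * z0 + (a^4+a^2) * z1 + (a^4+a^2) * z2 + (a^4+1) * z3,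
      (a^4+a^3) * z0 + (a+1) * z1 + (a^4+a^2) * z2 + (a^4+a^2) * z3]
      ∈ W.comap (fixedVec K) := by
  have h := mem_comap_fixedVec_of_mem hyW (xPlusEvenTau2_mulVec_mem hxW
    (yPlusTau2_mulVec_mem hyW (xPlusEvenTau2_mulVec_mem hxW
      (yPlusTau2_mulVec_mem hyW (yPlusTau2_mulVec_mem hyW (xPlusEvenTau2_mulVec_mem hxW hz))))))
  convert h using 1
  ext i
  fin_cases i <;> simp <;> grind

/-- A nonzero invariant subspace contains a nonzero vector fixed by `y''`. -/
theorem comap_fixedVec_ne_bot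
    (hxW : ∀ w ∈ W, (xPlusEvenTau2 K a).mulVec w ∈ W)
    (hyW : ∀ w ∈ W, (yPlusTau2 K).mulVec w ∈ W) (ha1 : a ≠ 1) (hW : W ≠ ⊥) :
    W.comap (fixedVec K) ≠ ⊥ := by
  intro hU
  have key : ∀ {w0 w1 w2 w3 w4 w5 w6 w7 : K}, ![w0, w1, w2, w3, w4, w5, w6, w7] ∈ W →
      w2 = 0 ∧ w6 = 0 ∧ w0 + w1 + w7 = 0 ∧ w3 + w4 + w5 = 0 := by
    intro w0 w1 w2 w3 w4 w5 w6 w7 hw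
    have h := mem_comap_fixedVec_of_mem hyW hw
    rw [hU, Submodule.mem_bot] at h
    exact ⟨congrFun h 0, congrFun h 1, congrFun h 2, congrFun h 3⟩
  have hc : a ^ 2 + 1 ≠ 0 := by
    have : (a + 1) * (a + 1) ≠ 0 := by
      have : a + 1 ≠ 0 := by grind
      exact mul_ne_zero this this
    grind
  have key2 : ∀ {w0 w1 w2 w3 w4 w5 w6 w7 : K}, ![w0, w1, w2, w3, w4, w5, w6, w7] ∈ W →
      w2 = 0 ∧ w3 = 0 ∧ w4 = 0 ∧ w5 = 0 ∧ w6 = 0 ∧ w7 = 0 := by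
    intro w0 w1 w2 w3 w4 w5 w6 w7 hw
    obtain ⟨h2, h6, -, h345⟩ := key hw
    obtain ⟨g2, g6, -, g345⟩ := key (xPlusEvenTau2_mulVec_mem hxW hw)
    have h5 : w5 = 0 := by simpa [h6] using g2
    have h4 : w4 = 0 := by simpa [h2, h5, hc] using g6
    have h3 : w3 = 0 := by simpa [h4, h5] using h345
    have h7 : w7 = 0 := by simpa [h4, h5] using g345
    exact ⟨h2, h3, h4, h5, h6, h7⟩
  refine hW ((Submodule.eq_bot_iff W).2 fun w hw ↦ ?_)
  have hw' : ![w 0, w 1, w 2, w 3, w 4, w 5, w 6, w 7] ∈ W := by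
    convert hw using 1
    ext i
    fin_cases i <;> rfl
  obtain ⟨h2, h3, h4, h5, h6, h7⟩ := key2 hw'
  have h1 := (key2 (yPlusTau2_mulVec_mem hyW hw')).2.2.2.2.2
  have h0 := (key2 (yPlusTau2_mulVec_mem hyW (yPlusTau2_mulVec_mem hyW hw'))).2.2.2.2.2
  ext i
  fin_cases i <;> assumption

/-- An invariant subspace containing all vectors fixed by `y''` is the whole space. -/
theorem eq_top_of_comap_fixedVec_eq_top
    (hxW : ∀ w ∈ W, (xPlusEvenTau2 K a).mulVec w ∈ W)
    (hyW : ∀ w ∈ W, (yPlusTau2 K).mulVec w ∈ W) (hU : W.comap (fixedVec K) = ⊤) :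
    W = ⊤ := by
  have hfix : ∀ z0 z1 z2 z3 : K, ![z2, z2, z0, z3, z3, z3, z1, z2] ∈ W := by
    intro z0 z1 z2 z3
    have h : ![z0, z1, z2, z3] ∈ W.comap (fixedVec K) := hU ▸ Submodule.mem_top
    exact h
  have he1 : ![0, 1, 0, 0, 0, 0, 0, 0] ∈ W := by
    convert W.sub_mem (xPlusEvenTau2_mulVec_mem hxW (hfix 0 1 0 0)) (hfix 1 0 0 0) using 1
    ext i
    fin_cases i <;> simp
  have he7 := yPlusTau2_mulVec_mem hyW he1
  have he0 := yPlusTau2_mulVec_mem hyW he7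
  have he3 : ![0, 0, 0, 1, 0, 0, 0, 0] ∈ W := by
    convert xPlusEvenTau2_mulVec_mem hxW he7 using 1
    ext i
    fin_cases i <;> simp
  have he4 := yPlusTau2_mulVec_mem hyW he3
  have he5 := yPlusTau2_mulVec_mem hyW he4
  refine (Submodule.eq_top_iff').2 fun w ↦ ?_
  have h := W.add_mem (hfix (w 2) (w 6) 0 0) <| W.add_mem (W.smul_mem (w 0) he0) <|
    W.add_mem (W.smul_mem (w 1) he1) <| W.add_mem (W.smul_mem (w 7) he7) <|
    W.add_mem (W.smul_mem (w 3) he3) <| W.add_mem (W.smul_mem (w 4) he4) (W.smul_mem (w 5) he5)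
  convert h using 1
  ext i
  fin_cases i <;> simp

/-- The characteristic equation of `compression a`, read off from an eigenvector. -/
theorem compression_eigenvalue_relation {t z0 z1 z2 z3 : K} (e0 : z1 + z3 = t * z0)
    (e1 : z0 + (a ^ 2 + a + 1) * z3 = t * z1)
    (e2 : (a ^ 2 + a + 1) * z0 + z1 + a ^ 2 * z2 = t * z2) (e3 : z2 + a ^ 2 * z3 = t * z3) :
    (t ^ 2 + (a ^ 2 + 1) * t + a) ^ 2 * z3 = 0 := by
  obtain rfl : z2 = (t + a ^ 2) * z3 := by grind
  obtain rfl : z1 = t * z0 + z3 := by grind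
  have h1 : (t ^ 2 + 1) * z0 = (t + (a ^ 2 + a + 1)) * z3 := by grind
  have h2 : (t + (a ^ 2 + a + 1)) * z0 = ((t + a ^ 2) ^ 2 + 1) * z3 := by grind
  have h : (t ^ 2 + 1) * ((t + a ^ 2) ^ 2 + 1) * z3 = (t + (a ^ 2 + a + 1)) ^ 2 * z3 := by
    linear_combination (t + (a ^ 2 + a + 1)) * h1 - (t ^ 2 + 1) * h2
  clear e0 e1 e2 e3 h1 h2
  grind

/-- A nonzero subspace stable under `compression a` contains the eigenvector attached to some
root of `t² + (a² + 1) t + a`. -/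
theorem exists_eigenvector_mem [IsAlgClosed K] (ha0 : a ≠ 0) (ha1 : a ≠ 1)
    {U : Submodule K (Fin 4 → K)} (hU : U ≠ ⊥) (hhU : ∀ z ∈ U, (compression a).mulVec z ∈ U) :
    ∃ t : K, t ^ 2 + (a ^ 2 + 1) * t + a = 0 ∧
      ![t + a ^ 2 + 1, t + a + 1, a ^ 2 + a, t + 1] ∈ U := by
  have : Nontrivial U := (Submodule.nontrivial_iff_ne_bot).2 hU
  obtain ⟨t, ht⟩ := Module.End.exists_eigenvalue
    ((Matrix.mulVecLin (compression a)).restrict (p := U) (q := U) hhU)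
  obtain ⟨⟨z, hz⟩, hzt, hz0⟩ := ht.exists_hasEigenvector
  rw [Module.End.mem_eigenspace_iff] at hzt
  have hzt : (compression a).mulVec z = t • z := congrArg Subtype.val hzt
  have hz0 : z ≠ 0 := fun h ↦ hz0 (Subtype.ext h)
  have e0 := congrFun hzt 0
  have e1 := congrFun hzt 1
  have e2 := congrFun hzt 2
  have e3 := congrFun hzt 3
  simp [compression_mulVec] at e0 e1 e2 e3
  have haa : a * (a + 1) ≠ 0 := mul_ne_zero ha0 (by grind)
  have h3 : z 3 ≠ 0 := by
    intro h
    have h2 : z 2 = 0 := by simpa [h] using e3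
    have h1 : z 1 = t * z 0 := by simpa [h] using e0
    have h0 : z 0 ≠ 0 := by
      intro h0
      apply hz0
      ext i
      fin_cases i <;> simp [h, h2, h1, h0]
    have ht : (t + 1) ^ 2 = 0 := by
      apply mul_right_cancel₀ h0
      grind
    have ht : t + 1 = 0 := pow_eq_zero_iff (two_ne_zero) |>.1 ht
    apply haa
    apply mul_right_cancel₀ h0
    grind
  have hq : t ^ 2 + (a ^ 2 + 1) * t + a = 0 := by
    have : (t ^ 2 + (a ^ 2 + 1) * t + a) ^ 2 = 0 := by
      simpa [h3] using compression_eigenvalue_relation e0 e1 e2 e3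
    exact pow_eq_zero_iff (two_ne_zero) |>.1 this
  have ht1 : t + 1 ≠ 0 := by
    intro h
    apply haa
    grind
  refine ⟨t, hq, ?_⟩
  have h0 : (t + 1) * z 0 = z 3 * (t + a ^ 2 + 1) := by
    apply mul_left_cancel₀ ht1
    grind
  convert U.smul_mem ((z 3)⁻¹ * (t + 1)) hz using 1
  ext i
  fin_cases i <;> simp [mul_assoc] <;> rw [eq_inv_mul_iff_mul_eq₀ h3] <;> grind

/-- A nonzero invariant subspace contains every vector fixed by `y''`. -/
theorem comap_fixedVec_eq_top [IsAlgClosed K] (ha0 : a ≠ 0) (ha1 : a ≠ 1)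
    (hxW : ∀ w ∈ W, (xPlusEvenTau2 K a).mulVec w ∈ W)
    (hyW : ∀ w ∈ W, (yPlusTau2 K).mulVec w ∈ W) (hW : W ≠ ⊥) :
    W.comap (fixedVec K) = ⊤ := by
  have hh : ∀ z ∈ W.comap (fixedVec K), (compression a).mulVec z ∈ W.comap (fixedVec K) :=
    fun z hz ↦ compression_mulVec_mem hxW hyW hz
  obtain ⟨t, hq, hu⟩ := exists_eigenvector_mem ha0 ha1 (comap_fixedVec_ne_bot hxW hyW ha1 hW) hh
  have hg := compression_xyxyyx_mem hxW hyW hu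
  have hk : ∀ {z0 z1 z2 z3 : K}, ![z0, z1, z2, z3] ∈ W.comap (fixedVec K) → _ :=
    fun hz ↦ compression_xyyx_mem hxW hyW hz
  generalize W.comap (fixedVec K) = U at *
  have hb : a + 1 ≠ 0 := by grind
  replace hg : ![a^4+a^3+a^2+1 + t * (a^4+a^2+1), a^4+a^3+a+1 + t * (a^3+a+1),
      a^5+a + t * (a^4+a^3+a^2+a), a^4+1 + t * (a^3+a^2+a+1)] ∈ U := by
    convert hg using 1
    ext i
    fin_cases i <;> simp <;> clear * - hq <;> grind
  -- With `h = compression a`, the image of `h² + (a² + 1) h + a` lies in the span of the eigenvectors of both roots.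
  have hm := U.add_mem (U.add_mem (hh _ (hh _ hg)) (U.smul_mem (a ^ 2 + 1) (hh _ hg)))
    (U.smul_mem a hg)
  replace hm : ![a^4+a^2 + t * (a^5+a^2), a^7+a^6+a^3+a^2 + t * (a^5+a^2),
      a^7+a^6+a^4+a^3, a^7+a^2 + t * (a^5+a^2)] ∈ U := by
    convert hm using 1
    ext i
    fin_cases i <;> simp [compression_mulVec] <;>
      clear * - <;> grind
  have hs : ![1, 1, 0, 1] ∈ U := by
    have hD : a ^ 6 * (a + 1) ^ 2 ≠ 0 := mul_ne_zero (pow_ne_zero _ ha0) (pow_ne_zero _ hb)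
    rw [← U.smul_mem_iff hD]
    convert U.add_mem (U.smul_mem (a ^ 6 + a ^ 3) hu) (U.smul_mem a hm) using 1
    ext i
    fin_cases i <;> simp <;> clear * - <;> grind
  have ht : ![a, 1, a + 1, 0] ∈ U := by
    rw [← U.smul_mem_iff ha0]
    convert U.add_mem hu (U.smul_mem (t + 1) hs) using 1
    ext i
    fin_cases i <;> simp <;> clear * - <;> grind
  have hv := hk ht
  have hn : ![1, 1, 0, 0] ∈ U := by
    rw [← U.smul_mem_iff hb]
    convert U.add_mem hv (U.add_mem (U.smul_mem (a ^ 2 + a) hs) (U.smul_mem a ht)) using 1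
    ext i
    fin_cases i <;> simp <;> clear * - <;> grind
  have hr : ![0, 0, 0, 1] ∈ U := by
    convert U.sub_mem hs hn using 1
    ext i
    fin_cases i <;> simp
  have hl : ![1, 0, 1, 0] ∈ U := by
    rw [← U.smul_mem_iff hb]
    convert U.add_mem ht hn using 1
    ext i
    fin_cases i <;> simp
    grind
  have he : ![1, 0, 0, 0] ∈ U := by
    have hD : a * (a + 1) ^ 2 ≠ 0 := mul_ne_zero ha0 (pow_ne_zero _ hb)
    rw [← U.smul_mem_iff hD]
    convert U.add_mem (hh _ hv) (U.add_mem (U.smul_mem (a ^ 4 + a ^ 3 + a ^ 2 + a) hr)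
      (U.add_mem (U.smul_mem (a ^ 4 + a + 1) hn) (U.smul_mem (a ^ 4 + a ^ 3) hl))) using 1
    ext i
    fin_cases i <;> simp [compression_mulVec] <;>
      clear * - <;> grind
  refine (Submodule.eq_top_iff').2 fun z ↦ ?_
  convert U.add_mem (U.smul_mem (z 0 - z 1 - z 2) he) (U.add_mem (U.smul_mem (z 1) hn)
    (U.add_mem (U.smul_mem (z 2) hl) (U.smul_mem (z 3) hr))) using 1
  ext i
  fin_cases i <;> simp

end Invariant

/-- An element generating a field with more than two elements and of characteristic two does not
lie in the prime field. -/
theorem ne_algebraMap_zmod_two {F : Type*} [Field F] [Fintype F] [Algebra (ZMod 2) F]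
    (hq : 4 ≤ Fintype.card F) {a : F} (ha : Subfield.closure {a} = ⊤) (c : ZMod 2) :
    a ≠ algebraMap (ZMod 2) F c := by
  rintro rfl
  have hle : Subfield.closure {algebraMap (ZMod 2) F c} ≤ (algebraMap (ZMod 2) F).fieldRange :=
    Subfield.closure_le.2 (by simp)
  rw [ha, top_le_iff, RingHom.fieldRange_eq_top_iff] at hle
  have := Fintype.card_le_of_surjective _ hle
  rw [ZMod.card] at this
  omega

end TauSquaredIrreducibility

open TauSquaredIrreducibility

/-- `⟨τ²(x), τ²(y)⟩` is absolutely irreducible for `q = 2^f ≥ 4` and `a` a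
generator of `𝔽_q`: the only subspaces of `K⁸` (`K` an algebraic closure of
`𝔽_q`) invariant under both `τ²(x)` and `τ²(y)` are `{0}` and `K⁸`. -/
theorem xPlusEvenTau2_yPlusTau2_absolutely_irreducible
    (f : ℕ) (F : Type*) [Field F] [Fintype F]
    (hcard : Fintype.card F = 2 ^ f) (hq : 4 ≤ Fintype.card F)
    (a : F) (ha : Subfield.closure {a} = ⊤)
    (K : Type*) [Field K] [Algebra F K] [IsAlgClosure F K]
    (W : Submodule K (Fin 8 → K))
    (hxW : ∀ w ∈ W, (xPlusEvenTau2 K (algebraMap F K a)).mulVec w ∈ W)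
    (hyW : ∀ w ∈ W, (yPlusTau2 K).mulVec w ∈ W) :
    W = ⊥ ∨ W = ⊤ := by
  have h2 : (2 : F) = 0 := by
    have h := Nat.cast_card_eq_zero F
    rw [hcard] at h
    push_cast at h
    exact eq_zero_of_pow_eq_zero h
  have : CharP F 2 := CharTwo.of_one_ne_zero_of_two_eq_zero one_ne_zero h2
  have : CharP K 2 := charP_of_injective_algebraMap (algebraMap F K).injective 2
  have : IsAlgClosed K := IsAlgClosure.isAlgClosed F
  let _ : Algebra (ZMod 2) F := ZMod.algebra F 2
  have ha0 : algebraMap F K a ≠ 0 := by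
    simpa using ne_algebraMap_zmod_two hq ha 0
  have ha1 : algebraMap F K a ≠ 1 := by
    simpa using ne_algebraMap_zmod_two hq ha 1
  by_cases hW : W = ⊥
  · exact Or.inl hW
  · exact Or.inr (eq_top_of_comap_fixedVec_eq_top hxW hyW
      (comap_fixedVec_eq_top ha0 ha1 hxW hyW hW))
end

section
/- Let p be an odd prime, q = p^f, and let a ∈ 𝔽_q* be such that the subfield of 𝔽_q generated by a is all of 𝔽_q, with a ≠ 2 and a ≠ −2. Let x = x(a) and y be the 8×8 matrices over 𝔽_q with rows x: [0,−1,0,0,0,0,0,0], [−1,0,0,0,0,0,0,0], [1,−1,−1,−a,0,0,0,0], [0,0,0,1,0,0,0,0], [0,0,0,1,0,−1,1,0], [0,0,0,−1,−1,0,−1,0], [0,0,0,−2,0,0,−1,0], [1,−1,−2,−2a,0,0,−a,1]; y: [1,0,0,0,0,0,0,0], [0,0,0,0,0,0,0,1], [0,0,0,0,0,1,0,0], [0,0,1,0,0,0,0,0], [0,0,0,0,1,0,0,0], [0,0,0,1,0,0,0,0], [0,1,0,0,0,0,0,0], [0,0,0,0,0,0,1,0]. Then: (i) for K an algebraic closure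 of 𝔽_q, the only K-subspaces W of K⁸ invariant under both x and y are {0} and K⁸ (i.e., ⟨x,y⟩ is absolutely irreducible); and (ii) the order of the element η = (xy²)²(xy)² ∈ GL₈(𝔽_q) is divisible by p. -/
open Matrix

/-- The generator `x = x(a)` of order 2 for `Ω₈⁺(q)` in odd characteristic. -/
def xPlusOdd (K : Type*) [Field K] (a : K) : Matrix (Fin 8) (Fin 8) K :=
  !![0, -1, 0, 0, 0, 0, 0, 0;
     -1, 0, 0, 0, 0, 0, 0, 0;
     1, -1, -1, -a, 0, 0, 0, 0;
     0, 0, 0, 1, 0, 0, 0, 0;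
     0, 0, 0, 1, 0, -1, 1, 0;
     0, 0, 0, -1, -1, 0, -1, 0;
     0, 0, 0, -2, 0, 0, -1, 0;
     1, -1, -2, -2*a, 0, 0, -a, 1]

/-- The generator `y` of order 3 for `Ω₈⁺(q)`. -/
def yPlus (K : Type*) [Field K] : Matrix (Fin 8) (Fin 8) K :=
  !![1, 0, 0, 0, 0, 0, 0, 0;
     0, 0, 0, 0, 0, 0, 0, 1;
     0, 0, 0, 0, 0, 1, 0, 0;
     0, 0, 1, 0, 0, 0, 0, 0;
     0, 0, 0, 0, 1, 0, 0, 0;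
     0, 0, 0, 1, 0, 0, 0, 0;
     0, 1, 0, 0, 0, 0, 0, 0;
     0, 0, 0, 0, 0, 0, 1, 0]

section Irreducibility

variable {K : Type*} [Field K]

theorem xPlusOdd_mulVec (a : K) (w : Fin 8 → K) :
    xPlusOdd K a *ᵥ w =
      ![-w 1, -w 0, w 0 - w 1 - w 2 - a * w 3, w 3, w 3 - w 5 + w 6, -w 3 - w 4 - w 6,
        -2 * w 3 - w 6, w 0 - w 1 - 2 * w 2 - 2 * a * w 3 - a * w 6 + w 7] := by
  ext i
  fin_cases i <;> simp [xPlusOdd, mulVec, dotProduct, Fin.sum_univ_eight] <;> ring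

theorem yPlus_mulVec (w : Fin 8 → K) :
    yPlus K *ᵥ w = ![w 0, w 7, w 5, w 2, w 4, w 3, w 1, w 6] := by
  ext i
  fin_cases i <;> simp [yPlus, mulVec, dotProduct, Fin.sum_univ_eight]

/-- The orthogonal complement of `W` for the bilinear form `∑ i, v i * w (i + 4)`. -/
def swapOrthogonal (W : Submodule K (Fin 8 → K)) : Submodule K (Fin 8 → K) where
  carrier := {v | ∀ w ∈ W, ∑ i, v i * w (i + 4) = 0}
  add_mem' hu hv w hw := by
    simp only [Pi.add_apply, add_mul, Finset.sum_add_distrib, hu w hw, hv w hw, add_zero]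
  zero_mem' w _ := by simp
  smul_mem' c v hv w hw := by
    simp only [Pi.smul_apply, smul_eq_mul, mul_assoc, ← Finset.mul_sum, hv w hw, mul_zero]

theorem mem_swapOrthogonal {W : Submodule K (Fin 8 → K)} {v : Fin 8 → K} :
    v ∈ swapOrthogonal W ↔ ∀ w ∈ W, v 0 * w 4 + v 1 * w 5 + v 2 * w 6 + v 3 * w 7 +
      v 4 * w 0 + v 5 * w 1 + v 6 * w 2 + v 7 * w 3 = 0 := by
  change (∀ w ∈ W, ∑ i, v i * w (i + 4) = 0) ↔ _
  simp only [Fin.sum_univ_eight]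
  rfl

theorem eq_bot_of_swapOrthogonal_eq_top {W : Submodule K (Fin 8 → K)}
    (h : swapOrthogonal W = ⊤) : W = ⊥ := by
  rw [Submodule.eq_bot_iff]
  intro w hw
  ext i
  have hi : Pi.single (i + 4) 1 ∈ swapOrthogonal W := h ▸ Submodule.mem_top
  have := mem_swapOrthogonal.1 hi w hw
  fin_cases i <;> simpa [Pi.single_apply] using this

variable {a : K} {W : Submodule K (Fin 8 → K)}

theorem xPlusOdd_mulVec_mem_swapOrthogonal (hx : ∀ w ∈ W, xPlusOdd K a *ᵥ w ∈ W) :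
    ∀ v ∈ swapOrthogonal W, xPlusOdd K a *ᵥ v ∈ swapOrthogonal W := by
  intro v hv
  rw [mem_swapOrthogonal] at hv ⊢
  intro w hw
  have := hv _ (hx w hw)
  simp [xPlusOdd_mulVec] at this ⊢
  linear_combination this

theorem yPlus_mulVec_mem_swapOrthogonal (hy : ∀ w ∈ W, yPlus K *ᵥ w ∈ W) :
    ∀ v ∈ swapOrthogonal W, yPlus K *ᵥ v ∈ swapOrthogonal W := by
  intro v hv
  rw [mem_swapOrthogonal] at hv ⊢
  intro w hw
  have := hv _ (hy _ (hy w hw))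
  simp [yPlus_mulVec] at this ⊢
  linear_combination this

theorem xPlusOdd_mem (hx : ∀ w ∈ W, xPlusOdd K a *ᵥ w ∈ W) {w0 w1 w2 w3 w4 w5 w6 w7 : K}
    (h : ![w0, w1, w2, w3, w4, w5, w6, w7] ∈ W) :
    ![-w1, -w0, w0 - w1 - w2 - a * w3, w3, w3 - w5 + w6, -w3 - w4 - w6,
      -2 * w3 - w6, w0 - w1 - 2 * w2 - 2 * a * w3 - a * w6 + w7] ∈ W := by
  simpa [xPlusOdd_mulVec] using hx _ h

theorem yPlus_mem (hy : ∀ w ∈ W, yPlus K *ᵥ w ∈ W) {w0 w1 w2 w3 w4 w5 w6 w7 : K}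
    (h : ![w0, w1, w2, w3, w4, w5, w6, w7] ∈ W) :
    ![w0, w7, w5, w2, w4, w3, w1, w6] ∈ W := by
  simpa [yPlus_mulVec] using hy _ h

theorem eq_top_of_single_seven_mem (ha2 : a ≠ 2)
    (hx : ∀ w ∈ W, xPlusOdd K a *ᵥ w ∈ W) (hy : ∀ w ∈ W, yPlus K *ᵥ w ∈ W)
    (h7 : ![0, 0, 0, 0, 0, 0, 0, 1] ∈ W) : W = ⊤ := by
  have h1 := yPlus_mem hy h7
  have h6 := yPlus_mem hy h1
  have h02 : ![1, 0, 1, 0, 0, 0, 0, 0] ∈ W := by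
    convert W.neg_mem (W.add_mem (xPlusOdd_mem hx h1) h7) using 1
    simp
  have h03 := yPlus_mem hy h02
  have h05 := yPlus_mem hy h03
  have h45 : ![0, 0, 0, 0, 1, -1, 0, 0] ∈ W := by
    convert W.add_mem (xPlusOdd_mem hx h6) (W.add_mem h6 (W.smul_mem a h7)) using 1
    simp
  have h2 : ![0, 0, 1, 0, 0, 0, 0, 0] ∈ W := by
    have h23 : ![0, 0, a - 1, -1, -1, 1, 0, 0] ∈ W := by
      convert W.add_mem (W.sub_mem (xPlusOdd_mem hx h02) (xPlusOdd_mem hx h03))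
        (W.add_mem (W.smul_mem (-2) h6) (W.smul_mem (2 - 2 * a) h7)) using 1
      ext i
      fin_cases i <;> simp
    have hne : a - 2 ≠ 0 := sub_ne_zero.2 ha2
    rw [← W.smul_mem_iff hne]
    convert W.add_mem h23 (W.add_mem h45 (W.sub_mem h03 h02)) using 1
    simp
    ring
  have h3 := yPlus_mem hy h2
  have h5 := yPlus_mem hy h3
  have h0 : ![1, 0, 0, 0, 0, 0, 0, 0] ∈ W := by
    convert W.sub_mem h02 h2 using 1
    simp
  have h4 : ![0, 0, 0, 0, 1, 0, 0, 0] ∈ W := by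
    convert W.add_mem h45 h5 using 1
    simp
  rw [eq_top_iff]
  intro w _
  convert W.add_mem (W.add_mem (W.add_mem (W.smul_mem (w 0) h0) (W.smul_mem (w 1) h1))
    (W.add_mem (W.smul_mem (w 2) h2) (W.smul_mem (w 3) h3)))
    (W.add_mem (W.add_mem (W.smul_mem (w 4) h4) (W.smul_mem (w 5) h5))
      (W.add_mem (W.smul_mem (w 6) h6) (W.smul_mem (w 7) h7))) using 1
  ext i
  fin_cases i <;> simp


/-- Invariant submodules are closed under `1 + y + y²`. -/
theorem yPlus_orbit_sum_mem (hy : ∀ w ∈ W, yPlus K *ᵥ w ∈ W) {w0 w1 w2 w3 w4 w5 w6 w7 : K}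
    (h : ![w0, w1, w2, w3, w4, w5, w6, w7] ∈ W) :
    ![3 * w0, w1 + w6 + w7, w2 + w3 + w5, w2 + w3 + w5, 3 * w4, w2 + w3 + w5,
      w1 + w6 + w7, w1 + w6 + w7] ∈ W := by
  have h1 := yPlus_mem hy h
  convert W.add_mem h (W.add_mem h1 (yPlus_mem hy h1)) using 1
  ext i
  fin_cases i <;> simp <;> ring

theorem eq_top_of_single_zero_add_single_four_mem (h2 : (2 : K) ≠ 0) (h3 : (3 : K) ≠ 0)
    (ha0 : a ≠ 0) (ha2 : a ≠ 2)
    (hx : ∀ w ∈ W, xPlusOdd K a *ᵥ w ∈ W) (hy : ∀ w ∈ W, yPlus K *ᵥ w ∈ W)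
    (hs : ![1, 0, 0, 0, 1, 0, 0, 0] ∈ W) : W = ⊤ := by
  have hz : ![-1, 0, -a, 1, 0, 0, -1, 1 - a] ∈ W := by
    convert xPlusOdd_mem hx (yPlus_mem hy (xPlusOdd_mem hx hs)) using 1
    ext i
    fin_cases i <;> simp <;> ring
  have hxyyz : ![1, 1, -1, 0, 1, a - 1, a - 1, a ^ 2 - a - 2] ∈ W := by
    convert xPlusOdd_mem hx (yPlus_mem hy (yPlus_mem hy hz)) using 1
    ext i
    fin_cases i <;> simp <;> ring
  have hq : ![-4 - a + a ^ 2, -2 - a + a ^ 2, -1 - 4 * a - a ^ 2 + a ^ 3, 4 + a - a ^ 2,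
      4 + a - a ^ 2, -3 - a + a ^ 2, -7 - 2 * a + 2 * a ^ 2,
      1 - 7 * a - 2 * a ^ 2 + 2 * a ^ 3] ∈ W := by
    convert xPlusOdd_mem hx (yPlus_mem hy (xPlusOdd_mem hx (yPlus_mem hy hxyyz))) using 1
    ext i
    fin_cases i <;> simp <;> ring
  have hxyz := xPlusOdd_mem hx (yPlus_mem hy hz)
  have hEz := yPlus_orbit_sum_mem hy hz
  have h0 : ![1, 0, 0, 0, 0, 0, 0, 0] ∈ W := by
    have hne : -12 * a * (a - 2) ≠ 0 := by
      have h12 : (-12 : K) = -(2 * 2 * 3) := by norm_num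
      rw [h12]
      exact mul_ne_zero (mul_ne_zero (neg_ne_zero.2 (mul_ne_zero (mul_ne_zero h2 h2) h3)) ha0)
        (sub_ne_zero.2 ha2)
    rw [← W.smul_mem_iff hne]
    convert W.add_mem (W.add_mem (W.smul_mem (-16 - 4 * a + 10 * a ^ 2 - 2 * a ^ 4) hEz)
      (W.smul_mem (-8 - 2 * a + 7 * a ^ 2 - a ^ 4)
        (W.sub_mem (yPlus_orbit_sum_mem hy hxyz) (W.smul_mem (-3 - 3 * a) hs))))
      (W.smul_mem (2 - 3 * a + a ^ 3)
        (W.sub_mem (yPlus_orbit_sum_mem hy hq) (W.smul_mem (12 + 3 * a - 3 * a ^ 2) hs))) using 1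
    ext i
    fin_cases i <;> simp <;> ring
  have h4 : ![0, 0, 0, 0, 1, 0, 0, 0] ∈ W := by
    convert W.sub_mem hs h0 using 1
    simp
  have h5 : ![0, 0, 0, 0, 0, 1, 0, 0] ∈ W := by
    convert W.neg_mem (xPlusOdd_mem hx h4) using 1
    simp
  have h2' := yPlus_mem hy h5
  have h3' := yPlus_mem hy h2'
  have hc : ![0, 1, 0, 0, 0, 0, 1, 1] ∈ W := by
    rw [← W.smul_mem_iff (neg_ne_zero.2 ha0)]
    convert W.add_mem hEz (W.add_mem (W.smul_mem 3 h0) (W.smul_mem (a - 1)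
      (W.add_mem h2' (W.add_mem h3' h5)))) using 1
    ext i
    fin_cases i <;> simp <;> ring
  have h71 : ![0, -1, 0, 0, 0, 0, 0, 1] ∈ W := by
    convert W.sub_mem (xPlusOdd_mem hx h0) h2' using 1
    simp
  have h16 := yPlus_mem hy h71
  apply eq_top_of_single_seven_mem ha2 hx hy
  rw [← W.smul_mem_iff h3]
  convert W.add_mem hc (W.add_mem (W.smul_mem 2 h71) h16) using 1
  ext i
  fin_cases i <;> simp <;> ring

/-- Norton's irreducibility criterion for an operator with one-dimensional kernel. -/
theorem mem_or_forall_eq_zero_of_ker_le_span {V : Type*} [AddCommGroup V] [Module K V]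
    [FiniteDimensional K V] {U : Submodule K V} {T : V →ₗ[K] V} {ψ : V →ₗ[K] K} {t : V}
    (hT : ∀ w ∈ U, T w ∈ U) (hker : LinearMap.ker T ≤ K ∙ t) (hψ : ∀ w, ψ (T w) = 0) :
    t ∈ U ∨ ∀ w ∈ U, ψ w = 0 := by
  by_cases ht : t ∈ U
  · exact Or.inl ht
  refine Or.inr fun w hw => ?_
  have hinj : Function.Injective (T.restrict hT) := by
    rw [← LinearMap.ker_eq_bot, LinearMap.ker_eq_bot']
    rintro ⟨u, hu⟩ h
    have hu0 : u ∈ LinearMap.ker T := congrArg Subtype.val h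
    obtain ⟨c, rfl⟩ := Submodule.mem_span_singleton.1 (hker hu0)
    have hc : c = 0 := by
      by_contra hc
      exact ht ((U.smul_mem_iff hc).1 hu)
    simp [hc]
  obtain ⟨u, hu⟩ := LinearMap.injective_iff_surjective.1 hinj ⟨w, hw⟩
  have : T u = w := congrArg Subtype.val hu
  rw [← this, hψ]

theorem mem_or_mem_swapOrthogonal_of_three_ne_zero (h2 : (2 : K) ≠ 0) (h3 : (3 : K) ≠ 0)
    (ha2' : a ≠ -2)
    (hx : ∀ w ∈ W, xPlusOdd K a *ᵥ w ∈ W) (hy : ∀ w ∈ W, yPlus K *ᵥ w ∈ W) :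
    ![0, -1, 1, 0, 0, -1, 0, 1] ∈ W ∨ ![0, -1, 1, 0, 0, -1, 0, 1] ∈ swapOrthogonal W := by
  set x := xPlusOdd K a with hxdef
  set y := yPlus K with hydef
  let e : Fin 8 → ((Fin 8 → K) →ₗ[K] K) := LinearMap.proj
  have key := mem_or_forall_eq_zero_of_ker_le_span (U := W)
    (T := y.mulVecLin + y.mulVecLin ∘ₗ y.mulVecLin +
      x.mulVecLin ∘ₗ y.mulVecLin ∘ₗ y.mulVecLin ∘ₗ x.mulVecLin)
    (ψ := e 3 - e 1 - e 5 + e 6)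
    (t := ![0, -1, 1, 0, 0, -1, 0, 1]) ?_ ?_ ?_
  · refine key.imp_right fun h => mem_swapOrthogonal.2 fun w hw => ?_
    have := h w hw
    simp [e] at this ⊢
    linear_combination this
  · intro w hw
    exact W.add_mem (W.add_mem (hy _ hw) (hy _ (hy _ hw))) (hx _ (hy _ (hy _ (hx _ hw))))
  · intro w hw
    have hw' := LinearMap.mem_ker.1 hw
    simp [hxdef, hydef, xPlusOdd_mulVec, yPlus_mulVec] at hw'
    obtain ⟨r0, r1, r2, r3, r4, -, r6, r7⟩ := hw'
    have ha : a + 2 ≠ 0 := fun h => ha2' (eq_neg_of_add_eq_zero_left h)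
    have h06 : w 0 = (a + 2) * w 6 := by linear_combination -r7 + a * r6 - a * r1
    have hsum : w 1 + w 2 + (1 + a) * w 3 + w 4 = 0 := by
      apply (mul_eq_zero_iff_left h2).1
      linear_combination r6 + h06
    have h46 : 2 * w 4 = (a + 2) * w 6 := by linear_combination hsum + r4 - r1
    have h04 : 2 * w 0 - w 4 = 0 := by
      apply (mul_eq_zero_iff_left ha).1
      linear_combination r3 - r2 - hsum + (a + 2) * r0
    have h4 : w 4 = 0 := by
      apply (mul_eq_zero_iff_left h3).1
      linear_combination h04 - 2 * h06 + 2 * h46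
    have h0 : w 0 = 0 := by linear_combination h06 - h46 + 2 * h4
    have h6 : w 6 = 0 := by
      apply (mul_eq_zero_iff_left ha).1
      linear_combination h0 - h06
    have h3 : w 3 = 0 := by
      apply (mul_eq_zero_iff_left h2).1
      linear_combination r0 - 2 * h0 - h6
    have h1 : w 1 = -w 7 := by linear_combination r1 - h6
    have h2 : w 2 = w 7 := by linear_combination hsum - (1 + a) * h3 - h4 - h1
    have h5 : w 5 = -w 7 := by linear_combination r3 + h3 + h4 + h6 - h2
    refine Submodule.mem_span_singleton.2 ⟨w 7, ?_⟩
    ext i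
    fin_cases i <;> simp [h0, h1, h2, h3, h4, h5, h6]
  · intro w
    simp [e, hxdef, hydef, xPlusOdd_mulVec, yPlus_mulVec]
    ring

theorem eq_bot_or_eq_top_of_three_ne_zero (h2 : (2 : K) ≠ 0) (h3 : (3 : K) ≠ 0)
    (ha0 : a ≠ 0) (ha2 : a ≠ 2) (ha2' : a ≠ -2)
    (hx : ∀ w ∈ W, xPlusOdd K a *ᵥ w ∈ W) (hy : ∀ w ∈ W, yPlus K *ᵥ w ∈ W) :
    W = ⊥ ∨ W = ⊤ := by
  have htop : ∀ U : Submodule K (Fin 8 → K), (∀ w ∈ U, xPlusOdd K a *ᵥ w ∈ U) →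
      (∀ w ∈ U, yPlus K *ᵥ w ∈ U) → ![0, -1, 1, 0, 0, -1, 0, 1] ∈ U → U = ⊤ := by
    intro U hxU hyU ht
    apply eq_top_of_single_zero_add_single_four_mem h2 h3 ha0 ha2 hxU hyU
    convert xPlusOdd_mem hxU ht using 1
    ext i
    fin_cases i <;> simp <;> ring
  rcases mem_or_mem_swapOrthogonal_of_three_ne_zero h2 h3 ha2' hx hy with ht | ht
  · exact Or.inr (htop W hx hy ht)
  · exact Or.inl (eq_bot_of_swapOrthogonal_eq_top (htop _
      (xPlusOdd_mulVec_mem_swapOrthogonal hx) (yPlus_mulVec_mem_swapOrthogonal hy) ht))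

theorem eq_top_of_orbit_sum_seven_mem (h3 : (3 : K) = 0) (ha0 : a ≠ 0) (ha2 : a ≠ 2)
    (hx : ∀ w ∈ W, xPlusOdd K a *ᵥ w ∈ W) (hy : ∀ w ∈ W, yPlus K *ᵥ w ∈ W)
    (hc : ![0, 1, 0, 0, 0, 0, 1, 1] ∈ W) : W = ⊤ := by
  have hd3 := xPlusOdd_mem hx hc
  have hd5 := yPlus_mem hy hd3
  have hd7 := yPlus_mem hy (xPlusOdd_mem hx (yPlus_mem hy hd5))
  apply eq_top_of_single_seven_mem ha2 hx hy
  rw [← W.smul_mem_iff ha0]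
  convert W.add_mem (W.add_mem hc hd3) (W.add_mem
    (W.smul_mem a (W.add_mem hd5 (xPlusOdd_mem hx hd5)))
    (W.add_mem hd7 (xPlusOdd_mem hx hd7))) using 1
  ext i
  fin_cases i <;> simp <;> grind

theorem eq_bot_or_eq_top_of_three_eq_zero (h2 : (2 : K) ≠ 0) (h3 : (3 : K) = 0)
    (ha0 : a ≠ 0) (ha2 : a ≠ 2) (ha2' : a ≠ -2)
    (hx : ∀ w ∈ W, xPlusOdd K a *ᵥ w ∈ W) (hy : ∀ w ∈ W, yPlus K *ᵥ w ∈ W) :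
    W = ⊥ ∨ W = ⊤ := by
  by_cases hW : ∀ w ∈ W, w 2 + w 3 + w 5 = 0
  · left
    apply eq_bot_of_swapOrthogonal_eq_top
    apply eq_top_of_orbit_sum_seven_mem h3 ha0 ha2 (xPlusOdd_mulVec_mem_swapOrthogonal hx)
      (yPlus_mulVec_mem_swapOrthogonal hy)
    refine mem_swapOrthogonal.2 fun w hw => ?_
    simp
    linear_combination hW w hw
  · right
    push Not at hW
    obtain ⟨w, hw, hne⟩ := hW
    have hvec : ![w 0, w 1, w 2, w 3, w 4, w 5, w 6, w 7] ∈ W := by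
      convert hw using 1
      ext i
      fin_cases i <;> rfl
    have hE := yPlus_orbit_sum_mem hy hvec
    have hyx := yPlus_mem hy (xPlusOdd_mem hx hE)
    have hyyx := yPlus_mem hy hyx
    have hc2 : ![0, 0, 1, 1, 0, 1, 0, 0] ∈ W := by
      rw [← W.smul_mem_iff (mul_ne_zero (neg_ne_zero.2 (pow_ne_zero 2 ha0)) hne)]
      convert W.add_mem (W.smul_mem (a ^ 2) hE) (W.sub_mem
        (yPlus_orbit_sum_mem hy (xPlusOdd_mem hx hyx))
        (yPlus_orbit_sum_mem hy (xPlusOdd_mem hx hyyx))) using 1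
      ext i
      fin_cases i <;> simp <;> grind
    apply eq_top_of_orbit_sum_seven_mem h3 ha0 ha2 hx hy
    have hne' : -(2 * (a + 2)) ≠ 0 :=
      neg_ne_zero.2 (mul_ne_zero h2 fun h => ha2' (eq_neg_of_add_eq_zero_left h))
    rw [← W.smul_mem_iff hne']
    convert W.add_mem (yPlus_orbit_sum_mem hy (xPlusOdd_mem hx hc2)) (W.smul_mem (1 + a) hc2)
      using 1
    ext i
    fin_cases i <;> simp <;> grind

end Irreducibility

section Order

variable {F : Type*} [Field F]

theorem eta_mulVec (a : F) (w : Fin 8 → F) :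
    ((xPlusOdd F a * (yPlus F) ^ 2) ^ 2 * (xPlusOdd F a * yPlus F) ^ 2) *ᵥ w =
      xPlusOdd F a *ᵥ yPlus F *ᵥ yPlus F *ᵥ xPlusOdd F a *ᵥ yPlus F *ᵥ yPlus F *ᵥ
        xPlusOdd F a *ᵥ yPlus F *ᵥ xPlusOdd F a *ᵥ yPlus F *ᵥ w := by
  simp only [pow_two, ← mulVec_mulVec]

theorem pow_mulVec_eq_add_nsmul {n : Type*} [Fintype n] [DecidableEq n] {M : Matrix n n F}
    {v k : n → F} (hk : M *ᵥ k = k) (hv : M *ᵥ v = v + k) (m : ℕ) :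
    M ^ m *ᵥ v = v + m • k := by
  induction m with
  | zero => simp
  | succ m ih =>
    rw [pow_succ', ← mulVec_mulVec, ih, mulVec_add, mulVec_smul, hk, hv, succ_nsmul']
    abel

theorem dvd_orderOf_of_mulVec_eq_add {n : Type*} [Fintype n] [DecidableEq n] (p : ℕ) [CharP F p]
    {M : Matrix n n F} {v k : n → F} (hk0 : k ≠ 0) (hk : M *ᵥ k = k) (hv : M *ᵥ v = v + k) :
    p ∣ orderOf M := by
  have h := pow_mulVec_eq_add_nsmul hk hv (orderOf M)
  rw [pow_orderOf_eq_one, one_mulVec, left_eq_add, ← Nat.cast_smul_eq_nsmul F] at h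
  exact (CharP.cast_eq_zero_iff F p _).1 ((smul_eq_zero.1 h).resolve_right hk0)

theorem dvd_orderOf_eta (p : ℕ) [CharP F p] (h2 : (2 : F) ≠ 0) {a : F} (ha0 : a ≠ 0)
    (ha2' : a ≠ -2) :
    p ∣ orderOf ((xPlusOdd F a * (yPlus F) ^ 2) ^ 2 * (xPlusOdd F a * yPlus F) ^ 2) := by
  have ha : a + 2 ≠ 0 := fun h => ha2' (eq_neg_of_add_eq_zero_left h)
  refine dvd_orderOf_of_mulVec_eq_add p
    (v := ![0, 0, 3 + 2 * a, 0, a, -(a * (3 + 2 * a)), -(2 * (3 + a)), 0])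
    (k := (-2 * a * (a + 2)) • ![0, 0, 0, 0, 1, -1, 0, 1]) ?_ ?_ ?_
  · refine smul_ne_zero (mul_ne_zero (mul_ne_zero (neg_ne_zero.2 h2) ha0) ha) fun h => ?_
    simpa using congrFun h 7
  · rw [mulVec_smul, eta_mulVec]
    congr 1
    have h1 : xPlusOdd F a *ᵥ yPlus F *ᵥ ![0, 0, 0, 0, 1, -1, 0, 1] =
        ![-1, 0, 0, 0, 0, -1, 0, 1] := by
      simp only [xPlusOdd_mulVec, yPlus_mulVec]
      ext i
      fin_cases i <;> simp <;> ring
    have h2 : xPlusOdd F a *ᵥ yPlus F *ᵥ ![-1, 0, 0, 0, 0, -1, 0, 1] =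
        ![-1, 1, -1, 0, 0, 0, 0, 0] := by
      simp only [xPlusOdd_mulVec, yPlus_mulVec]
      ext i
      fin_cases i <;> simp <;> ring
    have h3 : xPlusOdd F a *ᵥ yPlus F *ᵥ yPlus F *ᵥ ![-1, 1, -1, 0, 0, 0, 0, 0] =
        ![0, 1, -1, 0, 1, 0, 0, 0] := by
      simp only [xPlusOdd_mulVec, yPlus_mulVec]
      ext i
      fin_cases i <;> simp
    have h4 : xPlusOdd F a *ᵥ yPlus F *ᵥ yPlus F *ᵥ ![0, 1, -1, 0, 1, 0, 0, 0] =
        ![0, 0, 0, 0, 1, -1, 0, 1] := by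
      simp only [xPlusOdd_mulVec, yPlus_mulVec]
      ext i
      fin_cases i <;> simp
    rw [h1, h2, h3, h4]
  · rw [eta_mulVec]
    have h1 : xPlusOdd F a *ᵥ yPlus F *ᵥ
        ![0, 0, 3 + 2 * a, 0, a, -(a * (3 + 2 * a)), -(2 * (3 + a)), 0] =
        ![0, 0, 0, 3 + 2 * a, 3 + 2 * a, -3 - 3 * a, -6 - 4 * a, -6 - 2 * a] := by
      simp only [xPlusOdd_mulVec, yPlus_mulVec]
      ext i
      fin_cases i <;> simp <;> ring
    have h2 : xPlusOdd F a *ᵥ yPlus F *ᵥ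
        ![0, 0, 0, 3 + 2 * a, 3 + 2 * a, -3 - 3 * a, -6 - 4 * a, -6 - 2 * a] =
        ![6 + 2 * a, 0, 9 + 5 * a, 0, -3 - 2 * a, -3 - 2 * a, 0, 6 + 4 * a] := by
      simp only [xPlusOdd_mulVec, yPlus_mulVec]
      ext i
      fin_cases i <;> simp <;> ring
    have h3 : xPlusOdd F a *ᵥ yPlus F *ᵥ yPlus F *ᵥ
        ![6 + 2 * a, 0, 9 + 5 * a, 0, -3 - 2 * a, -3 - 2 * a, 0, 6 + 4 * a] =
        ![0, -6 - 2 * a, 6 + 5 * a + 2 * a ^ 2, -3 - 2 * a, -6 - 3 * a, 0, 0, 6 + 2 * a] := by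
      simp only [xPlusOdd_mulVec, yPlus_mulVec]
      ext i
      fin_cases i <;> simp <;> ring
    have h4 : xPlusOdd F a *ᵥ yPlus F *ᵥ yPlus F *ᵥ
        ![0, -6 - 2 * a, 6 + 5 * a + 2 * a ^ 2, -3 - 2 * a, -6 - 3 * a, 0, 0, 6 + 2 * a] =
        ![0, 0, 3 + 2 * a, 0, -3 * a - 2 * a ^ 2, a, -6 - 2 * a, -4 * a - 2 * a ^ 2] := by
      simp only [xPlusOdd_mulVec, yPlus_mulVec]
      ext i
      fin_cases i <;> simp <;> ring
    rw [h1, h2, h3, h4]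
    ext i
    fin_cases i <;> simp <;> ring

end Order

theorem xPlusOdd_map {F K : Type*} [Field F] [Field K] [Algebra F K] (a : F) :
    (xPlusOdd F a).map (algebraMap F K) = xPlusOdd K (algebraMap F K a) := by
  ext i j
  fin_cases i <;> fin_cases j <;> simp [xPlusOdd, map_ofNat (algebraMap F K) 2]

theorem yPlus_map {F K : Type*} [Field F] [Field K] [Algebra F K] :
    (yPlus F).map (algebraMap F K) = yPlus K := by
  ext i j
  fin_cases i <;> fin_cases j <;> simp [yPlus]

/-- For `q = p^f` odd, `a ∈ 𝔽_q*` a generator of `𝔽_q` with `a ≠ ±2`: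
(i) `⟨x(a), y⟩` is absolutely irreducible, i.e. the only subspaces of `K⁸`
(`K` an algebraic closure of `𝔽_q`) invariant under both `x(a)` and `y` are
`{0}` and `K⁸`; and (ii) the order of `η = (xy²)²(xy)²` is divisible by `p`. -/
theorem xPlusOdd_yPlus_absolutely_irreducible_and_eta_order
    (p f : ℕ) (hp : p.Prime) (hpodd : Odd p) (hf : 1 ≤ f)
    (F : Type*) [Field F] [Fintype F] (hcard : Fintype.card F = p ^ f)
    (a : F) (ha0 : a ≠ 0) (ha2 : a ≠ 2) (ha2' : a ≠ -2)
    (ha : Subfield.closure {a} = ⊤)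
    (K : Type*) [Field K] [Algebra F K] [IsAlgClosure F K] :
    (∀ W : Submodule K (Fin 8 → K),
      (∀ w ∈ W, ((xPlusOdd F a).map (algebraMap F K)).mulVec w ∈ W) →
      (∀ w ∈ W, ((yPlus F).map (algebraMap F K)).mulVec w ∈ W) →
      W = ⊥ ∨ W = ⊤) ∧
    p ∣ orderOf ((xPlusOdd F a * (yPlus F) ^ 2) ^ 2 * (xPlusOdd F a * yPlus F) ^ 2) := by
  have : Fact p.Prime := ⟨hp⟩
  have : CharP F p := charP_of_card_eq_prime_pow hcard
  have h2 : (2 : F) ≠ 0 := by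
    intro h
    have h' : ((2 : ℕ) : F) = 0 := by exact_mod_cast h
    have hdvd := (CharP.cast_eq_zero_iff F p 2).1 h'
    rw [(Nat.prime_dvd_prime_iff_eq hp Nat.prime_two).1 hdvd] at hpodd
    exact absurd hpodd (by decide)
  refine ⟨fun W hx hy => ?_, dvd_orderOf_eta p h2 ha0 ha2'⟩
  rw [xPlusOdd_map] at hx
  rw [yPlus_map] at hy
  have hinj := (algebraMap F K).injective
  have h2map : algebraMap F K 2 = 2 := map_ofNat _ 2
  have h2K : (2 : K) ≠ 0 := h2map ▸ (map_ne_zero_iff _ hinj).2 h2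
  have ha0K := (map_ne_zero_iff (algebraMap F K) hinj).2 ha0
  have ha2K : algebraMap F K a ≠ 2 := h2map ▸ hinj.ne ha2
  have ha2K' : algebraMap F K a ≠ -2 := by
    rw [← h2map, ← map_neg]
    exact hinj.ne ha2'
  by_cases h3 : (3 : K) = 0
  · exact eq_bot_or_eq_top_of_three_eq_zero h2K h3 ha0K ha2K ha2K' hx hy
  · exact eq_bot_or_eq_top_of_three_ne_zero h2K h3 ha0K ha2K ha2K' hx hy
end

section
/- Let p be an odd prime, q = p^f, and let a ∈ 𝔽_q* with a ≠ −2 be such that the subfield of 𝔽_q generated by a is all of 𝔽_q. Let K be an algebraic closure of 𝔽_q, and let x' and y' be the 8×8 matrices over K with rows x': [1,0,0,0,0,0,0,0], [0,−1,0,0,0,0,0,0], [0,1,0,1,0,0,0,0], [0,1,1,0,0,0,0,0], [0,−a,0,0,1,0,0,0], [−a,0,−1,1,0,−1,1,1], [0,−1,−2,0,0,0,0,1], [0,1,0,2,0,0,1,0]; y': [0,0,0,−1,0,0,0,0], [0,0,0,0,1,0,0,0], [0,0,−1,0,0,0,0,0], [0,0,0,0,0,1,0,0], [0,0,0,0,0,0,0,−1],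 [1,0,0,0,0,0,0,0], [0,0,0,0,0,0,−1,0], [0,1,0,0,0,0,0,0]. Then the only K-subspaces W of K⁸ with x'·W ⊆ W and y'·W ⊆ W are {0} and K⁸; that is, the subgroup ⟨x', y'⟩ of GL₈(K) is absolutely irreducible. -/
open Matrix

/-- The image `x' = τ(x(a))` under triality of the order-2 generator of
`Ω₈⁺(q)` in odd characteristic. -/
def xPlusOddTau (K : Type*) [Field K] (a : K) : Matrix (Fin 8) (Fin 8) K :=
  !![1, 0, 0, 0, 0, 0, 0, 0;
     0, -1, 0, 0, 0, 0, 0, 0;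
     0, 1, 0, 1, 0, 0, 0, 0;
     0, 1, 1, 0, 0, 0, 0, 0;
     0, -a, 0, 0, 1, 0, 0, 0;
     -a, 0, -1, 1, 0, -1, 1, 1;
     0, -1, -2, 0, 0, 0, 0, 1;
     0, 1, 0, 2, 0, 0, 1, 0]

/-- The image `y' = τ(y)` under triality of the order-3 generator of `Ω₈⁺(q)`. -/
def yPlusTau (K : Type*) [Field K] : Matrix (Fin 8) (Fin 8) K :=
  !![0, 0, 0, -1, 0, 0, 0, 0;
     0, 0, 0, 0, 1, 0, 0, 0;
     0, 0, -1, 0, 0, 0, 0, 0;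
     0, 0, 0, 0, 0, 1, 0, 0;
     0, 0, 0, 0, 0, 0, 0, -1;
     1, 0, 0, 0, 0, 0, 0, 0;
     0, 0, 0, 0, 0, 0, -1, 0;
     0, 1, 0, 0, 0, 0, 0, 0]

/-- Norton's criterion for a simple eigenvector: a subspace invariant under `M` either contains
the right eigenvector `v` or is annihilated by the left eigenvector `φ`. -/
theorem mem_or_forall_dotProduct_eq_zero {K n : Type*} [Field K] [Fintype n]
    {M : Matrix n n K} {μ : K} {v φ : n → K} {U : Submodule K (n → K)}
    (hU : ∀ w ∈ U, M *ᵥ w ∈ U) (hv : ∀ w, M *ᵥ w = μ • w → ∃ c : K, w = c • v)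
    (hφ : φ ᵥ* M = μ • φ) : v ∈ U ∨ ∀ w ∈ U, φ ⬝ᵥ w = 0 := by
  by_contra! h
  obtain ⟨hvU, w, hw, hφw⟩ := h
  let g : (n → K) →ₗ[K] (n → K) := M.mulVecLin - μ • LinearMap.id
  have hgU : ∀ w ∈ U, g w ∈ U := fun w hw => U.sub_mem (hU w hw) (U.smul_mem μ hw)
  have hinj : Function.Injective (g.restrict hgU) := by
    rw [← LinearMap.ker_eq_bot, LinearMap.ker_eq_bot']
    rintro ⟨z, hz⟩ hgz
    have hMz : M *ᵥ z = μ • z := sub_eq_zero.mp (congrArg Subtype.val hgz)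
    obtain ⟨c, rfl⟩ := hv z hMz
    have hc : c = 0 := by
      by_contra hc
      exact hvU ((U.smul_mem_iff hc).mp hz)
    simp [hc]
  obtain ⟨⟨z, hz⟩, hgz⟩ := LinearMap.surjective_of_injective hinj ⟨w, hw⟩
  have hzw : M *ᵥ z - μ • z = w := congrArg Subtype.val hgz
  apply hφw
  rw [← hzw, dotProduct_sub, dotProduct_mulVec, hφ, smul_dotProduct, dotProduct_smul, sub_self]

section Compression

variable {K : Type*} [Field K]

/-- The columns form a basis of the `-1`-eigenspace of `xPlusOddTau K a`. -/
def negEigenBasis (a : K) : Matrix (Fin 8) (Fin 4) K :=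
  !![0, 0, 0, 0;
     0, 0, 0, -2;
     0, 0, 1, 1;
     0, 0, -1, 1;
     0, 0, 0, -a;
     1, 0, 0, 0;
     0, 1, 2, -1;
     0, -1, 0, 1]

/-- The coordinates of `(xPlusOddTau K a - 1) *ᵥ w` in the basis `negEigenBasis a`. -/
def negEigenCoord (a : K) : Matrix (Fin 4) (Fin 8) K :=
  !![-a, 0, -1, 1, 0, -2, 1, 1;
     0, 0, 0, -2, 0, 0, -1, 1;
     0, 0, -1, 1, 0, 0, 0, 0;
     0, 1, 0, 0, 0, 0, 0, 0]

theorem negEigenBasis_mul_negEigenCoord (a : K) :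
    negEigenBasis a * negEigenCoord a = xPlusOddTau K a - 1 := by
  ext i j
  fin_cases i <;> fin_cases j <;>
    simp [negEigenBasis, negEigenCoord, xPlusOddTau, Matrix.mul_apply, Fin.sum_univ_succ] <;> ring

/-- The compression of `yPlusTau K` to the `-1`-eigenspace of `xPlusOddTau K a`. -/
def compressY (a : K) : Matrix (Fin 4) (Fin 4) K :=
  !![1, -1, -1 - a, a;
     -2, 1, 2, -3;
     1, 0, 1, 1;
     0, 0, 0, -a]

/-- The compression of the square of `yPlusTau K` to the `-1`-eigenspace of `xPlusOddTau K a`. -/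
def compressYSq (a : K) : Matrix (Fin 4) (Fin 4) K :=
  !![a, 1, -1, -a;
     0, -1, -2, 1 - a;
     0, 0, -1, -1;
     0, 1, 0, -1]

/-- The compression of `y' * x' * y' ^ 2`, for `x' = xPlusOddTau K a` and `y' = yPlusTau K`,
to the `-1`-eigenspace of `x'`. -/
def compressYXYSq (a : K) : Matrix (Fin 4) (Fin 4) K :=
  !![2 + a, 2 + a, 2 + a, 0;
     -2 * a, -4, -2, 2 + a;
     a, 2, 0, -2 - a;
     0, -a, 0, 2 + a]

theorem yPlusTau_mulVec (w : Fin 8 → K) :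
    yPlusTau K *ᵥ w = ![-w 3, w 4, -w 2, w 5, -w 7, w 0, -w 6, w 1] := by
  ext i
  fin_cases i <;> simp [yPlusTau, mulVec, dotProduct, Fin.sum_univ_succ]

theorem xPlusOddTau_mulVec (a : K) (w : Fin 8 → K) :
    xPlusOddTau K a *ᵥ w = ![w 0, -w 1, w 1 + w 3, w 1 + w 2, -a * w 1 + w 4,
      -a * w 0 - w 2 + w 3 - w 5 + w 6 + w 7, -w 1 - 2 * w 2 + w 7,
      w 1 + 2 * w 3 + w 6] := by
  ext i
  fin_cases i <;> simp [xPlusOddTau, mulVec, dotProduct, Fin.sum_univ_succ] <;> ring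

theorem negEigenBasis_mulVec (a : K) (c : Fin 4 → K) :
    negEigenBasis a *ᵥ c = ![0, -2 * c 3, c 2 + c 3, -c 2 + c 3, -a * c 3, c 0,
      c 1 + 2 * c 2 - c 3, -c 1 + c 3] := by
  ext i
  fin_cases i <;> simp [negEigenBasis, mulVec, dotProduct, Fin.sum_univ_succ] <;> ring

theorem negEigenCoord_mulVec (a : K) (w : Fin 8 → K) :
    negEigenCoord a *ᵥ w = ![-a * w 0 - w 2 + w 3 - 2 * w 5 + w 6 + w 7,
      -2 * w 3 - w 6 + w 7, -w 2 + w 3, w 1] := by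
  ext i
  fin_cases i <;> simp [negEigenCoord, mulVec, dotProduct, Fin.sum_univ_succ] <;> ring

theorem compressY_mulVec (a : K) (c : Fin 4 → K) :
    compressY a *ᵥ c = ![c 0 - c 1 - (1 + a) * c 2 + a * c 3,
      -2 * c 0 + c 1 + 2 * c 2 - 3 * c 3, c 0 + c 2 + c 3, -a * c 3] := by
  ext i
  fin_cases i <;> simp [compressY, mulVec, dotProduct, Fin.sum_univ_succ] <;> ring

theorem compressYSq_mulVec (a : K) (c : Fin 4 → K) :
    compressYSq a *ᵥ c = ![a * c 0 + c 1 - c 2 - a * c 3,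
      -c 1 - 2 * c 2 + (1 - a) * c 3, -c 2 - c 3, c 1 - c 3] := by
  ext i
  fin_cases i <;> simp [compressYSq, mulVec, dotProduct, Fin.sum_univ_succ] <;> ring

theorem compressYXYSq_mulVec (a : K) (c : Fin 4 → K) :
    compressYXYSq a *ᵥ c = ![(2 + a) * (c 0 + c 1 + c 2),
      -2 * a * c 0 - 4 * c 1 - 2 * c 2 + (2 + a) * c 3, a * c 0 + 2 * c 1 - (2 + a) * c 3,
      -a * c 1 + (2 + a) * c 3] := by
  ext i
  fin_cases i <;> simp [compressYXYSq, mulVec, dotProduct, Fin.sum_univ_succ] <;> ring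

theorem compressY_mulVec_eq (a : K) (c : Fin 4 → K) :
    compressY a *ᵥ c = negEigenCoord a *ᵥ yPlusTau K *ᵥ negEigenBasis a *ᵥ c := by
  rw [compressY_mulVec, negEigenCoord_mulVec, yPlusTau_mulVec, negEigenBasis_mulVec]
  ext i
  fin_cases i <;> simp <;> ring

theorem compressYSq_mulVec_eq (a : K) (c : Fin 4 → K) :
    compressYSq a *ᵥ c =
      negEigenCoord a *ᵥ yPlusTau K *ᵥ yPlusTau K *ᵥ negEigenBasis a *ᵥ c := by
  rw [compressYSq_mulVec, negEigenCoord_mulVec, yPlusTau_mulVec, yPlusTau_mulVec,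
    negEigenBasis_mulVec]
  ext i
  fin_cases i <;> simp <;> ring

theorem compressYXYSq_mulVec_eq (a : K) (c : Fin 4 → K) :
    compressYXYSq a *ᵥ c = negEigenCoord a *ᵥ yPlusTau K *ᵥ xPlusOddTau K a *ᵥ yPlusTau K *ᵥ
      yPlusTau K *ᵥ negEigenBasis a *ᵥ c := by
  simp only [compressYXYSq_mulVec, negEigenCoord_mulVec, yPlusTau_mulVec, xPlusOddTau_mulVec,
    negEigenBasis_mulVec, Matrix.cons_val]
  ext i
  fin_cases i <;> simp <;> ring

theorem eq_smul_of_compressYSq_mulVec {a : K} (ha2 : a + 2 ≠ 0) {c : Fin 4 → K}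
    (hc : compressYSq a *ᵥ c = a • c) : ∃ k : K, c = k • ![1, 0, 0, 0] := by
  rw [compressYSq_mulVec] at hc
  have e0 := congrFun hc 0
  have e2 := congrFun hc 2
  have e3 := congrFun hc 3
  simp at e0 e2 e3
  have h2 : c 2 = 0 := by
    have : (a + 2) * c 2 = 0 := by
      linear_combination -e0 + e3 - e2
    exact (mul_eq_zero.mp this).resolve_left ha2
  have h3 : c 3 = 0 := by linear_combination -e2 - (1 + a) * h2
  have h1 : c 1 = 0 := by linear_combination e3 + (1 + a) * h3
  refine ⟨c 0, ?_⟩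
  ext i
  fin_cases i <;> simp [h1, h2, h3]

theorem eq_smul_of_compressY_mulVec {a : K} (ha2 : a + 2 ≠ 0) {c : Fin 4 → K}
    (hc : compressY a *ᵥ c = -a • c) :
    ∃ k : K, c = k • ![(a + 2) * (a - 1), -(a + 3), 1, 1 - 2 * a - a ^ 2] := by
  rw [compressY_mulVec] at hc
  have e0 := congrFun hc 0
  have e1 := congrFun hc 1
  have e2 := congrFun hc 2
  simp at e0 e1 e2
  have h3 : c 3 = c 2 * (1 - 2 * a - a ^ 2) := by
    apply mul_left_cancel₀ ha2
    linear_combination -e1 - (1 + a) * e0 + ((1 + a) ^ 2 - 2) * e2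
  have h0 : c 0 = c 2 * ((a + 2) * (a - 1)) := by linear_combination e2 - h3
  have h1 : c 1 = c 2 * -(a + 3) := by
    linear_combination -e0 + (1 + a) * h0 + a * h3
  refine ⟨c 2, ?_⟩
  ext i
  fin_cases i <;> simp [h0, h1, h3]

/-- The compressions of `⟨x', y'⟩` act irreducibly on the `-1`-eigenspace of `x'`. -/
theorem eq_bot_or_eq_top_of_compress {a : K} (h2 : (2 : K) ≠ 0) (ha0 : a ≠ 0) (ha2 : a + 2 ≠ 0)
    {U : Submodule K (Fin 4 → K)} (hY : ∀ c ∈ U, compressY a *ᵥ c ∈ U)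
    (hYSq : ∀ c ∈ U, compressYSq a *ᵥ c ∈ U) (hYXYSq : ∀ c ∈ U, compressYXYSq a *ᵥ c ∈ U) :
    U = ⊥ ∨ U = ⊤ := by
  rcases mem_or_forall_dotProduct_eq_zero (v := ![1, 0, 0, 0])
    (φ := ![a ^ 2 + 2 * a - 1, 1, -1 - a, 2 - a - a ^ 2]) hYSq
    (fun c hc => eq_smul_of_compressYSq_mulVec ha2 hc)
    (by
      ext j
      fin_cases j <;> simp [compressYSq, vecMul, dotProduct, Fin.sum_univ_succ] <;> ring)
    with he | hφ
  · right
    have m1 := hY _ he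
    have m2 := hY _ m1
    have m3 := hYSq _ m1
    rw [Submodule.eq_top_iff']
    intro c
    have hc : c = (c 0 + (c 1 + c 2 - c 3 / 2) - (2 - a) * (c 2 - c 3 / 2 + c 1 / 2)
          + (a - 3) * (c 3 / 2)) • ![1, 0, 0, 0]
        + (-c 1 - c 2 + c 3 / 2) • compressY a *ᵥ ![1, 0, 0, 0]
        + (c 2 - c 3 / 2 + c 1 / 2) • compressY a *ᵥ compressY a *ᵥ ![1, 0, 0, 0]
        + (-c 3 / 2) • compressYSq a *ᵥ compressY a *ᵥ ![1, 0, 0, 0] := by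
      simp only [compressY_mulVec, compressYSq_mulVec]
      ext i
      fin_cases i <;> simp <;> field_simp <;> ring
    rw [hc]
    exact U.add_mem (U.add_mem (U.add_mem (U.smul_mem _ he) (U.smul_mem _ m1))
      (U.smul_mem _ m2)) (U.smul_mem _ m3)
  rcases mem_or_forall_dotProduct_eq_zero
    (v := ![(a + 2) * (a - 1), -(a + 3), 1, 1 - 2 * a - a ^ 2])
    (φ := ![0, 0, 0, 1]) hY (fun c hc => eq_smul_of_compressY_mulVec ha2 hc)
    (by
      ext j
      fin_cases j <;> simp [compressY, vecMul, dotProduct, Fin.sum_univ_succ])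
    with hv | hψ
  · exfalso
    have p1 := hφ _ hv
    have p2 := hφ _ (hYXYSq _ hv)
    rw [compressYXYSq_mulVec] at p2
    simp [dotProduct, Fin.sum_univ_succ] at p1 p2
    have q1 : a ^ 2 + a - 3 = 0 := by
      have : 2 * a * (a + 2) * (a ^ 2 + a - 3) = 0 := by linear_combination p1
      simpa [h2, ha0, ha2] using this
    have q2 : (2 * 2 * 2) * (a + 2) = 0 := by
      linear_combination -p2 + 2 * (a + 2) * (a ^ 2 - 4) * q1
    simp [h2, ha2] at q2
  · left
    rw [Submodule.eq_bot_iff]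
    have last : ∀ c ∈ U, c 3 = 0 := fun c hc => by
      simpa [dotProduct, Fin.sum_univ_succ] using hψ c hc
    have second : ∀ c ∈ U, c 1 = 0 := fun c hc => by
      have h := last _ (hYSq c hc)
      simpa [compressYSq_mulVec, last c hc] using h
    have third : ∀ c ∈ U, c 2 = 0 := fun c hc => by
      have h := second _ (hYSq c hc)
      simpa [compressYSq_mulVec, last c hc, second c hc, h2] using h
    have first : ∀ c ∈ U, c 0 = 0 := fun c hc => by
      have h := third _ (hY c hc)
      simpa [compressY_mulVec, last c hc, third c hc] using h
    intro c hc
    ext i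
    fin_cases i <;> simp [first c hc, second c hc, third c hc, last c hc]

theorem eq_zero_of_negEigenCoord_mulVec {a : K} (ha0 : a ≠ 0) {w : Fin 8 → K}
    (h0 : negEigenCoord a *ᵥ w = 0) (h1 : negEigenCoord a *ᵥ yPlusTau K *ᵥ w = 0)
    (h2 : negEigenCoord a *ᵥ yPlusTau K *ᵥ yPlusTau K *ᵥ w = 0) : w = 0 := by
  simp only [negEigenCoord_mulVec, yPlusTau_mulVec] at h0 h1 h2
  have e02 := congrFun h0 2
  have e03 := congrFun h0 3
  have e10 := congrFun h1 0
  have e12 := congrFun h1 2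
  have e13 := congrFun h1 3
  have e21 := congrFun h2 1
  have e22 := congrFun h2 2
  have e23 := congrFun h2 3
  simp at e02 e03 e10 e12 e13 e21 e22 e23
  have w0 : w 0 = 0 := by
    apply mul_left_cancel₀ ha0
    linear_combination e10 - e12 - e21 - e03 + e13 - a * e02 + a * e22
  have w2 : w 2 = 0 := by linear_combination w0 - e22
  have w3 : w 3 = 0 := by linear_combination e02 + w2
  have w5 : w 5 = 0 := by linear_combination e12 - w2
  have w6 : w 6 = 0 := by linear_combination -e21 + e13 - 2 * w0
  ext i
  fin_cases i <;> simp [*]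

/-- A subspace that contains the `-1`-eigenspace of `x'` and is invariant under `y'` is the
whole space. -/
theorem eq_top_of_negEigenBasis_mem {a : K} (ha0 : a ≠ 0) {W : Submodule K (Fin 8 → K)}
    (hy : ∀ w ∈ W, yPlusTau K *ᵥ w ∈ W) (hB : ∀ c, negEigenBasis a *ᵥ c ∈ W) : W = ⊤ := by
  rw [Submodule.eq_top_iff']
  intro w
  obtain ⟨t, ht⟩ : ∃ t, a * t = w 6 - w 1 - 2 * w 2 + w 4 + w 7 :=
    ⟨_, mul_div_cancel₀ _ ha0⟩
  have hw : w = negEigenBasis a *ᵥ ![w 5, -w 7 - t, w 2 + t, -t]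
      + yPlusTau K *ᵥ negEigenBasis a *ᵥ ![w 3 + w 2 + 2 * t, w 4 - a * t, 0, 0]
      + yPlusTau K *ᵥ yPlusTau K *ᵥ negEigenBasis a *ᵥ ![-w 0, w 1 - 2 * t, 0, 0] := by
    simp only [negEigenBasis_mulVec, yPlusTau_mulVec]
    ext i
    fin_cases i <;> simp <;> first | ring1 | linear_combination -ht
  rw [hw]
  exact W.add_mem (W.add_mem (hB _) (hy _ (hB _))) (hy _ (hy _ (hB _)))

theorem eq_bot_or_eq_top_of_invariant {a : K} (h2 : (2 : K) ≠ 0) (ha0 : a ≠ 0)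
    (ha2 : a + 2 ≠ 0) {W : Submodule K (Fin 8 → K)}
    (hx : ∀ w ∈ W, xPlusOddTau K a *ᵥ w ∈ W) (hy : ∀ w ∈ W, yPlusTau K *ᵥ w ∈ W) :
    W = ⊥ ∨ W = ⊤ := by
  let U : Submodule K (Fin 4 → K) := W.comap (negEigenBasis a).mulVecLin
  have hU : ∀ w ∈ W, negEigenCoord a *ᵥ w ∈ U := fun w hw => by
    change negEigenBasis a *ᵥ negEigenCoord a *ᵥ w ∈ W
    rw [mulVec_mulVec, negEigenBasis_mul_negEigenCoord, sub_mulVec, one_mulVec]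
    exact W.sub_mem (hx w hw) hw
  rcases eq_bot_or_eq_top_of_compress (U := U) h2 ha0 ha2
    (fun c hc => compressY_mulVec_eq a c ▸ hU _ (hy _ hc))
    (fun c hc => compressYSq_mulVec_eq a c ▸ hU _ (hy _ (hy _ hc)))
    (fun c hc => compressYXYSq_mulVec_eq a c ▸ hU _ (hy _ (hx _ (hy _ (hy _ hc)))))
    with hbot | htop
  · left
    rw [Submodule.eq_bot_iff]
    have hzero : ∀ w ∈ W, negEigenCoord a *ᵥ w = 0 := fun w hw => by
      simpa [hbot] using hU w hw
    exact fun w hw => eq_zero_of_negEigenCoord_mulVec ha0 (hzero w hw) (hzero _ (hy w hw))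
      (hzero _ (hy _ (hy w hw)))
  · right
    refine eq_top_of_negEigenBasis_mem ha0 hy fun c => ?_
    have hc : c ∈ U := htop ▸ Submodule.mem_top
    exact hc

end Compression

/-- For `q = p^f` odd and `a ∈ 𝔽_q*` a generator of `𝔽_q` with `a ≠ -2`,
`⟨τ(x), τ(y)⟩` is absolutely irreducible: the only subspaces of `K⁸` (`K` an
algebraic closure of `𝔽_q`) invariant under both `τ(x)` and `τ(y)` are `{0}`
and `K⁸`. -/
theorem xPlusOddTau_yPlusTau_absolutely_irreducible
    (p f : ℕ) (hp : p.Prime) (hpodd : Odd p) (hf : 1 ≤ f)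
    (F : Type*) [Field F] [Fintype F] (hcard : Fintype.card F = p ^ f)
    (a : F) (ha0 : a ≠ 0) (ha2' : a ≠ -2)
    (ha : Subfield.closure {a} = ⊤)
    (K : Type*) [Field K] [Algebra F K] [IsAlgClosure F K]
    (W : Submodule K (Fin 8 → K))
    (hxW : ∀ w ∈ W, (xPlusOddTau K (algebraMap F K a)).mulVec w ∈ W)
    (hyW : ∀ w ∈ W, (yPlusTau K).mulVec w ∈ W) :
    W = ⊥ ∨ W = ⊤ := by
  have h2F : (2 : F) ≠ 0 := by
    intro h
    have : Fact p.Prime := ⟨hp⟩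
    have hchar : CharP F p := charP_of_card_eq_prime_pow hcard
    have hp2 : p ∣ 2 := (CharP.cast_eq_zero_iff F p 2).mp (by exact_mod_cast h)
    rw [(Nat.prime_dvd_prime_iff_eq hp Nat.prime_two).mp hp2] at hpodd
    exact absurd hpodd (by decide)
  refine eq_bot_or_eq_top_of_invariant ?_ ((map_ne_zero _).mpr ha0) ?_ hxW hyW
  · rw [← map_ofNat (algebraMap F K) 2, map_ne_zero]
    exact h2F
  · rw [← map_ofNat (algebraMap F K) 2, ← map_add, map_ne_zero]
    exact fun h => ha2' (eq_neg_of_add_eq_zero_left h)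
end

section
/- Let p be an odd prime, q = p^f, and let a ∈ 𝔽_q* with a ≠ −2 be such that the subfield of 𝔽_q generated by a is all of 𝔽_q. Let K be an algebraic closure of 𝔽_q, and let x'' and y'' be the 8×8 matrices over K with rows x'': [0,0,0,−1,−a,1,−1,0], [0,0,0,0,1,0,0,0], [0,−1,−1,0,−1,0,0,0], [0,0,0,1,0,0,0,0], [0,1,0,0,0,0,0,0], [1,a,0,−1,0,0,−1,0], [0,0,0,−2,0,0,−1,0], [0,−1,−2,0,−1,0,0,1]; y'': [0,0,0,0,0,0,0,1], [−1,0,0,0,0,0,0,0], [0,0,−1,0,0,0,0,0], [0,0,0,0,0,1,0,0], [0,0,0,1,0,0,0,0], [0,0,0,0,−1,0,0,0], [0,0,0,0,0,0,−1,0], [0,1,0,0,0,0,0,0]. Then the only K-subspaces W of K⁸ with x''·W ⊆ W and y''·W ⊆ W are {0} and K⁸; that is, the subgroup ⟨x'', y''⟩ of GL₈(K) is absolutely irreducible. -/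
open Matrix

/-- The image `x'' = τ²(x(a))` under the square of triality of the order-2
generator of `Ω₈⁺(q)` in odd characteristic. -/
def xPlusOddTau2 (K : Type*) [Field K] (a : K) : Matrix (Fin 8) (Fin 8) K :=
  !![0, 0, 0, -1, -a, 1, -1, 0;
     0, 0, 0, 0, 1, 0, 0, 0;
     0, -1, -1, 0, -1, 0, 0, 0;
     0, 0, 0, 1, 0, 0, 0, 0;
     0, 1, 0, 0, 0, 0, 0, 0;
     1, a, 0, -1, 0, 0, -1, 0;
     0, 0, 0, -2, 0, 0, -1, 0;
     0, -1, -2, 0, -1, 0, 0, 1]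

section

variable {K : Type*} [Field K]

lemma xPlusOddTau2_mulVec (a : K) (w : Fin 8 → K) :
    xPlusOddTau2 K a *ᵥ w =
      ![-w 3 - a * w 4 + w 5 - w 6, w 4, -w 1 - w 2 - w 4, w 3, w 1,
        w 0 + a * w 1 - w 3 - w 6, -2 * w 3 - w 6, -w 1 - 2 * w 2 - w 4 + w 7] := by
  ext i
  fin_cases i <;> simp [xPlusOddTau2, mulVec, dotProduct, Fin.sum_univ_succ] <;> ring

lemma yPlusTau2_mulVec (w : Fin 8 → K) :
    yPlusTau2 K *ᵥ w = ![w 7, -w 0, -w 2, w 5, w 3, -w 4, -w 6, w 1] := by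
  ext i
  fin_cases i <;> simp [yPlusTau2, mulVec, dotProduct, Fin.sum_univ_succ]

/-- A cubic polynomial in `s * y`, multiplied on the right by `s`, applied to `w`. With `s = 1 ± x`
and suitable coefficients it is an endomorphism of rank one. -/
def cubicCorner (s y : (Fin 8 → K) → Fin 8 → K) (c₂ c₁ c₀ : K) (w : Fin 8 → K) : Fin 8 → K :=
  s (y (s (y (s (y (s w)) + c₂ • s w)) + c₁ • s w)) + c₀ • s w

lemma cubicCorner_mem {s y : (Fin 8 → K) → Fin 8 → K} {W : Submodule K (Fin 8 → K)}
    (hs : ∀ w ∈ W, s w ∈ W) (hy : ∀ w ∈ W, y w ∈ W) (c₂ c₁ c₀ : K) {w : Fin 8 → K} (hw : w ∈ W) :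
    cubicCorner s y c₂ c₁ c₀ w ∈ W := by
  have add_smul_mem {z : Fin 8 → K} (hz : z ∈ W) (c : K) : s (y z) + c • s w ∈ W :=
    W.add_mem (hs _ (hy _ hz)) (W.smul_mem c (hs _ hw))
  exact add_smul_mem (add_smul_mem (add_smul_mem (hs _ hw) _) _) _

lemma add_xPlusOddTau2_mulVec (a : K) (w : Fin 8 → K) :
    w + xPlusOddTau2 K a *ᵥ w =
      ![w 0 - w 3 - a * w 4 + w 5 - w 6, w 1 + w 4, -w 1 - w 4, 2 * w 3, w 1 + w 4,
        w 0 + a * w 1 - w 3 + w 5 - w 6, -2 * w 3, -w 1 - 2 * w 2 - w 4 + 2 * w 7] := by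
  rw [xPlusOddTau2_mulVec]
  ext i
  fin_cases i <;> simp only [Pi.add_apply] <;> simp <;> ring

lemma sub_xPlusOddTau2_mulVec (a : K) (w : Fin 8 → K) :
    w - xPlusOddTau2 K a *ᵥ w =
      ![w 0 + w 3 + a * w 4 - w 5 + w 6, w 1 - w 4, w 1 + 2 * w 2 + w 4, 0, w 4 - w 1,
        -w 0 - a * w 1 + w 3 + w 5 + w 6, 2 * w 3 + 2 * w 6, w 1 + 2 * w 2 + w 4] := by
  rw [xPlusOddTau2_mulVec]
  ext i
  fin_cases i <;> simp only [Pi.sub_apply] <;> simp <;> ring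

lemma cubicCorner_add_xPlusOddTau2 (a : K) (w : Fin 8 → K) :
    cubicCorner (fun z ↦ z + xPlusOddTau2 K a *ᵥ z) (fun z ↦ yPlusTau2 K *ᵥ z)
        1 (-a) (4 - 2 * a - 2 * a ^ 2) w =
      (4 * (w 2 - w 7)) • ![a, -1, 1, a, -1, 0, -a, a ^ 2 + a - 1] := by
  simp only [cubicCorner, add_xPlusOddTau2_mulVec, yPlusTau2_mulVec]
  ext i
  fin_cases i <;> simp <;> ring

lemma cubicCorner_sub_xPlusOddTau2 (a : K) (w : Fin 8 → K) :
    cubicCorner (fun z ↦ z - xPlusOddTau2 K a *ᵥ z) (fun z ↦ yPlusTau2 K *ᵥ z)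
        3 (2 - a) (-2 * a - 2) w =
      (4 * (a * w 0 + w 1 + a * w 2 - w 3 + (a ^ 2 + a - 1) * w 4 - a * w 5 - w 6)) •
        ![0, 0, 0, 0, 0, 1, 1, 0] := by
  simp only [cubicCorner, sub_xPlusOddTau2_mulVec, yPlusTau2_mulVec]
  ext i
  fin_cases i <;> simp <;> ring

/-- A homogeneous linear system of determinant `± 2 a (a + 2) ^ 4`. -/
lemma eq_zero_of_spin_equations {a : K} (h2 : (2 : K) ≠ 0) (ha : a ≠ 0) (ha2 : a + 2 ≠ 0)
    {w : Fin 8 → K} (h₁ : w 2 = w 7) (h₂ : w 1 + w 2 = 0) (h₃ : w 0 + w 2 = 0)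
    (h₄ : w 1 + w 2 + w 3 + (a + 1) * w 4 - w 5 + w 6 = 0)
    (h₅ : -w 2 - w 3 + w 4 - (a + 1) * w 5 - w 6 + w 7 = 0)
    (h₆ : -w 0 - w 2 + (a + 1) * w 3 + w 4 + w 5 - w 6 = 0)
    (h₇ : w 0 + (a + 2) * w 1 + w 2 + (a + 3) * w 3 + (a + 1) * w 4 - w 5 + w 6 = 0)
    (h₈ : -(a + 1) * w 0 + (-a ^ 2 - a + 1) * w 1 - w 2 + (a + 2) * w 3 + (a + 2) * w 6 + w 7
      = 0) :
    w = 0 := by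
  have h45 : w 4 = w 5 := mul_left_cancel₀ ha2 (by linear_combination h₄ + h₅ - h₂ + h₁)
  have h34 : w 3 = -w 4 :=
    mul_left_cancel₀ ha2 (by linear_combination h₄ + h₆ - h₂ + h₃)
  have h6 : w 6 = (1 - a) * w 4 := by linear_combination h₄ - h₂ - h34 - h45
  have h72 : w 4 = -w 2 := mul_left_cancel₀ ha2 (by
    linear_combination -h₇ + h₃ + (a + 2) * h₂ + (a + 3) * h34 + h45 + h6)
  have h4 : w 4 = w 2 := mul_left_cancel₀ (mul_ne_zero ha ha2) (by
    linear_combination -h₈ - (a + 1) * h₃ + (-a ^ 2 - a + 1) * h₂ + (a + 2) * h34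
      + (a + 2) * h6 - h₁)
  have h2z : w 2 = 0 := mul_left_cancel₀ h2 (by linear_combination h72 - h4)
  ext i
  fin_cases i <;> simp <;> grind

theorem eq_bot_or_eq_top_of_xPlusOddTau2_of_yPlusTau2 {a : K} (h2 : (2 : K) ≠ 0) (ha : a ≠ 0)
    (ha2 : a + 2 ≠ 0) {W : Submodule K (Fin 8 → K)}
    (hx : ∀ w ∈ W, xPlusOddTau2 K a *ᵥ w ∈ W) (hy : ∀ w ∈ W, yPlusTau2 K *ᵥ w ∈ W) :
    W = ⊥ ∨ W = ⊤ := by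
  have h4 : (4 : K) ≠ 0 := by
    rw [show (4 : K) = 2 * 2 by norm_num]
    exact mul_ne_zero h2 h2
  have hyy (w) (hw : w ∈ W) : yPlusTau2 K *ᵥ yPlusTau2 K *ᵥ w ∈ W := hy _ (hy _ hw)
  by_cases hu : ![a, -1, 1, a, -1, 0, -a, a ^ 2 + a - 1] ∈ W
  swap
  · left
    have key (w) (hw : w ∈ W) : w 2 = w 7 := by
      by_contra hne
      have hmem := cubicCorner_mem (s := fun z ↦ z + xPlusOddTau2 K a *ᵥ z)
        (fun z hz ↦ W.add_mem hz (hx z hz)) hy 1 (-a) (4 - 2 * a - 2 * a ^ 2) hw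
      rw [cubicCorner_add_xPlusOddTau2,
        W.smul_mem_iff (mul_ne_zero h4 (sub_ne_zero.mpr hne))] at hmem
      exact hu hmem
    refine (Submodule.eq_bot_iff W).mpr fun w hw ↦ ?_
    have e₁ := key _ hw
    have e₂ := key _ (hy _ hw)
    have e₃ := key _ (hyy _ hw)
    have e₄ := key _ (hyy _ (hx _ hw))
    have e₅ := key _ (hyy _ (hx _ (hyy _ hw)))
    have e₆ := key _ (hyy _ (hx _ (hy _ hw)))
    have e₇ := key _ (hyy _ (hx _ (hy _ (hx _ hw))))
    have e₈ := key _ (hyy _ (hx _ (hyy _ (hx _ hw))))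
    simp [xPlusOddTau2_mulVec, yPlusTau2_mulVec] at e₁ e₂ e₃ e₄ e₅ e₆ e₇ e₈
    apply eq_zero_of_spin_equations h2 ha ha2 <;> grind
  right
  have hv : ![0, 0, 0, 0, 0, 1, 1, 0] ∈ W := by
    by_contra hv
    have key (w) (hw : w ∈ W) :
        a * w 0 + w 1 + a * w 2 - w 3 + (a ^ 2 + a - 1) * w 4 - a * w 5 - w 6 = 0 := by
      by_contra hne
      have hmem := cubicCorner_mem (s := fun z ↦ z - xPlusOddTau2 K a *ᵥ z)
        (fun z hz ↦ W.sub_mem hz (hx z hz)) hy 3 (2 - a) (-2 * a - 2) hw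
      rw [cubicCorner_sub_xPlusOddTau2, W.smul_mem_iff (mul_ne_zero h4 hne)] at hmem
      exact hv hmem
    have e₁ := key _ (hy _ hu)
    have e₂ := key _ (hyy _ (hx _ (hyy _ hu)))
    have e₃ := key _ (hyy _ (hx _ (hy _ (hx _ (hyy _ hu)))))
    simp [xPlusOddTau2_mulVec, yPlusTau2_mulVec] at e₁ e₂ e₃
    have hq : a ^ 2 + a - 3 = 0 :=
      mul_left_cancel₀ (mul_ne_zero h2 ha) (by linear_combination e₁)
    exact mul_ne_zero h2 h4 (by linear_combination (2 * a - 8) * hq - e₂ - e₃)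
  by_contra hW
  obtain ⟨φ, hφ, hWφ⟩ := Submodule.exists_le_ker_of_lt_top W (lt_top_iff_ne_top.mpr hW)
  have key (w) (hw : w ∈ W) : ∑ i, w i * φ (Pi.single i 1) = 0 := by
    have hw' : φ w = 0 := hWφ hw
    rw [← Finset.univ_sum_single w, map_sum] at hw'
    rw [← hw']
    refine Finset.sum_congr rfl fun i _ ↦ ?_
    rw [← smul_eq_mul, ← map_smul, ← Pi.single_smul, smul_eq_mul, mul_one]
  have e₁ := key _ hv
  have e₂ := key _ (hy _ hv)
  have e₃ := key _ (hyy _ hv)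
  have e₄ := key _ (hx _ (hyy _ hv))
  have e₅ := key _ (hyy _ (hx _ (hyy _ hv)))
  have e₆ := key _ (hy _ (hx _ (hyy _ hv)))
  have e₇ := key _ (hx _ (hy _ (hx _ (hyy _ hv))))
  have e₈ := key _ (hx _ (hyy _ (hx _ (hyy _ hv))))
  simp [xPlusOddTau2_mulVec, yPlusTau2_mulVec, Fin.sum_univ_eight] at e₁ e₂ e₃ e₄ e₅ e₆ e₇ e₈
  have hz : (fun i : Fin 8 ↦ φ (Pi.single (i + 4) 1)) = 0 := by
    apply eq_zero_of_spin_equations h2 ha ha2 <;> simp <;> grind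
  refine hφ (LinearMap.pi_ext' fun i ↦ LinearMap.ext_ring ?_)
  simpa [sub_add_cancel] using congrFun hz (i - 4)

end

/-- For `q = p^f` odd and `a ∈ 𝔽_q*` a generator of `𝔽_q` with `a ≠ -2`,
`⟨τ²(x), τ²(y)⟩` is absolutely irreducible: the only subspaces of `K⁸` (`K` an
algebraic closure of `𝔽_q`) invariant under both `τ²(x)` and `τ²(y)` are `{0}`
and `K⁸`. -/
theorem xPlusOddTau2_yPlusTau2_absolutely_irreducible
    (p f : ℕ) (hp : p.Prime) (hpodd : Odd p) (hf : 1 ≤ f)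
    (F : Type*) [Field F] [Fintype F] (hcard : Fintype.card F = p ^ f)
    (a : F) (ha0 : a ≠ 0) (ha2' : a ≠ -2)
    (ha : Subfield.closure {a} = ⊤)
    (K : Type*) [Field K] [Algebra F K] [IsAlgClosure F K]
    (W : Submodule K (Fin 8 → K))
    (hxW : ∀ w ∈ W, (xPlusOddTau2 K (algebraMap F K a)).mulVec w ∈ W)
    (hyW : ∀ w ∈ W, (yPlusTau2 K).mulVec w ∈ W) :
    W = ⊥ ∨ W = ⊤ := by
  have h2 : (2 : F) ≠ 0 := by
    refine Ring.two_ne_zero fun h ↦ ?_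
    have heven := FiniteField.even_card_iff_char_two.mp h
    rw [hcard, ← Nat.even_iff] at heven
    exact Nat.not_even_iff_odd.mpr hpodd.pow heven
  refine eq_bot_or_eq_top_of_xPlusOddTau2_of_yPlusTau2 ?_
    ((map_ne_zero (algebraMap F K)).mpr ha0) ?_ hxW hyW
  · rw [← map_ofNat (algebraMap F K) 2]
    exact (map_ne_zero _).mpr h2
  · rw [← map_ofNat (algebraMap F K) 2, ← map_add]
    exact (map_ne_zero _).mpr fun h ↦ ha2' (eq_neg_of_add_eq_zero_left h)
end

section
/- Let q be a prime power, let F = 𝔽_{q²}, and let σ: F → F be the field automorphism λ ↦ λ^q; for a matrix A over F write A^σ for the matrix obtained by applying σ to every entry. Then for every g ∈ GL₃(F) with gᵀ·g^σ = I₃ and det(g) = 1 (i.e., g ∈ SU₃(q²)), there exists a matrix A ∈ Mat₃(F) such that Aᵀ = A^σ, g·A = A·g, and A is not a scalar multiple of the identity matrix. -/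
open Matrix

/-- A square matrix that is unitary with respect to a nontrivial involution `σ` of the base field
commutes with a non-scalar `σ`-Hermitian matrix. -/
theorem exists_nonscalar_hermitian_commute {ι F : Type*} [Fintype ι] [DecidableEq ι] [Nontrivial ι]
    [Field F] (σ : F →+* F) (hσ : ∀ x, σ (σ x) = x) {l : F} (hl : σ l ≠ l)
    (g : Matrix ι ι F) (hg : gᵀ * g.map σ = 1) :
    ∃ A : Matrix ι ι F, Aᵀ = A.map σ ∧ g * A = A * g ∧ ∀ c : F, A ≠ c • (1 : Matrix ι ι F) := by
  by_cases hs : ∃ c : F, g = c • (1 : Matrix ι ι F)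
  · obtain ⟨c, rfl⟩ := hs
    obtain ⟨i, j, hij⟩ := exists_pair_ne ι
    refine ⟨single i i 1, ?_, by simp, fun d hd => ?_⟩
    · ext a b
      simp [single_apply, and_comm, apply_ite σ]
    · have hi := congrFun₂ hd i i
      have hj := congrFun₂ hd j j
      simp [hij] at hi hj
      exact one_ne_zero (hi.trans hj.symm)
  · set h : Matrix ι ι F := (g.map σ)ᵀ
    have hhg : h * g = 1 := by simpa [h] using congrArg transpose hg
    have hgh : g * h = 1 := mul_eq_one_comm.mp hhg
    have herm : ∀ m : F, (m • g + σ m • h)ᵀ = (m • g + σ m • h).map σ := by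
      intro m
      ext a b
      simp [h, hσ, add_comm]
    have comm : ∀ m : F, g * (m • g + σ m • h) = (m • g + σ m • h) * g := by
      intro m
      simp [mul_add, add_mul, hgh, hhg]
    by_contra! hcon
    obtain ⟨c, hc⟩ := hcon _ (herm 1) (comm 1)
    obtain ⟨d, hd⟩ := hcon _ (herm l) (comm l)
    refine hs ⟨(σ l - l)⁻¹ * (σ l * c - d), ?_⟩
    have hne : σ l - l ≠ 0 := sub_ne_zero.mpr hl
    have key : (σ l - l) • g = (σ l * c - d) • (1 : Matrix ι ι F) := by
      rw [sub_smul (σ l * c), mul_smul, ← hc, ← hd, map_one]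
      module
    rw [mul_smul, ← key, inv_smul_smul₀ hne]

/-- The power map `x ↦ x ^ q` is not the identity on a finite field with `q ^ 2` elements. -/
theorem FiniteField.exists_pow_ne_self {F : Type*} [Field F] [Fintype F] {q : ℕ} (hq : 1 < q)
    (hcard : Fintype.card F = q ^ 2) : ∃ x : F, x ^ q ≠ x := by
  by_contra! hx
  have hunits : ∀ x : Fˣ, x ^ (q - 1) = 1 := by
    intro x
    have hxq : x ^ q = x := Units.ext (by simpa using hx x)
    refine mul_right_cancel (b := x) ?_
    rw [← pow_succ, Nat.sub_add_cancel hq.le, hxq, one_mul]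
  have hdvd := (FiniteField.forall_pow_eq_one_iff F (q - 1)).mp hunits
  rw [hcard] at hdvd
  have hle := Nat.le_of_dvd (by omega) hdvd
  have : q < q ^ 2 := by nlinarith
  omega

/-- Every element `g` of the special unitary group `SU₃(q²)` (over the field
`F = 𝔽_{q²}`, with `σ : λ ↦ λ^q` the involutory field automorphism) centralizes
some non-scalar matrix `A` with `Aᵀ = A^σ`. -/
theorem su3_centralizes_nonscalar_hermitian
    (q : ℕ) (hq : ∃ p n : ℕ, p.Prime ∧ 0 < n ∧ q = p ^ n)
    (F : Type*) [Field F] [Fintype F] (hcard : Fintype.card F = q ^ 2)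
    (g : Matrix (Fin 3) (Fin 3) F)
    (hgu : gᵀ * g.map (fun t => t ^ q) = 1) (hgdet : g.det = 1) :
    ∃ A : Matrix (Fin 3) (Fin 3) F,
      Aᵀ = A.map (fun t => t ^ q) ∧ g * A = A * g ∧
      ∀ c : F, A ≠ c • (1 : Matrix (Fin 3) (Fin 3) F) := by
  obtain ⟨p, n, hp, hn, rfl⟩ := hq
  have : Fact p.Prime := ⟨hp⟩
  have : CharP F p := charP_of_card_eq_prime_pow (f := n * 2) (by rw [hcard, pow_mul])
  obtain ⟨l, hl⟩ := FiniteField.exists_pow_ne_self (Nat.one_lt_pow hn.ne' hp.one_lt) hcard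
  have hσ : ∀ x : F, iterateFrobenius F p n (iterateFrobenius F p n x) = x := by
    intro x
    rw [iterateFrobenius_def, iterateFrobenius_def, ← pow_mul, ← sq, ← hcard, FiniteField.pow_card]
  exact exists_nonscalar_hermitian_commute (iterateFrobenius F p n) hσ hl g hgu
end
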